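/- arXiv:2303.10924 — 15 statements merged into one kernel-verified Lean document; each statement's English description precedes it below -/
import Mathlib

section
/- Let cl = 𝒵 ∪ 𝒳 ⊆ ℤ² be a maximal exceptional set on the toric variety X(ℓ,v;c), constructed as in the context. Then cl is strongly exceptional (i.e. B − A ∈ Acyc for all A, B ∈ cl) if and only if no layer cl(k), k ∈ K, is displaced; equivalently, if and only if the set of points {cl(k)^L : k ∈ K} is totally ordered by the componentwise order on ℤ². -/
/-- `CH⁰`, the effective cone `Eff = {(i,j) | j ≥ 0, i ≥ −αj}`. -/
def CH0 (α : ℤ) : Set (ℤ × ℤ) := {p | 0 ≤ p.2 ∧ -(α * p.2) ≤ p.1}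

/-- `CH^ℓ = {(i,j) | j ≥ 0, i ≤ −ℓ−1}`. -/
def CHl (ℓ : ℕ) : Set (ℤ × ℤ) := {p | 0 ≤ p.2 ∧ p.1 ≤ -(ℓ : ℤ) - 1}

/-- `CH^v = {(i,j) | j ≤ −v−1, i ≥ β}`. -/
def CHv (v : ℕ) (β : ℤ) : Set (ℤ × ℤ) := {p | p.2 ≤ -(v : ℤ) - 1 ∧ β ≤ p.1}

/-- `CH^{ℓ+v} = {(i,j) | j ≤ −v−1, i ≤ β−ℓ−1+α(−v−1−j)}`. -/
def CHlv (ℓ v : ℕ) (α β : ℤ) : Set (ℤ × ℤ) :=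
  {p | p.2 ≤ -(v : ℤ) - 1 ∧ p.1 ≤ β - (ℓ : ℤ) - 1 + α * (-(v : ℤ) - 1 - p.2)}

/-- The acyclic locus of `X(ℓ,v;c)`. -/
def Acyc (ℓ v : ℕ) (α β : ℤ) : Set (ℤ × ℤ) :=
  (CHl ℓ ∪ CHv v β ∪ CHlv ℓ v α β)ᶜ

/-- The data of a maximal exceptional set `cl = 𝒵 ∪ 𝒳` on `X(ℓ,v;c)`:
an admissible set `𝒳` together with a choice of horizontal chains
`C(k) = {(a k, k),…,(a k + ℓ, k)}` for `v+1 ≤ k ≤ 2v+1` whose right-hand end is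
`𝒳(k)` whenever `𝒳(k) ≠ ∅`. -/
structure MesetData (ℓ v : ℕ) (α β : ℤ) where
  /-- the admissible set `𝒳` -/
  X : Set (ℤ × ℤ)
  /-- the left endpoints of the chosen horizontal chains `C(k)` -/
  a : ℤ → ℤ
  /-- `𝒳 ⊆ ΔUp` -/
  hXsub : ∀ p ∈ X, -β < p.1 ∧ (v : ℤ) < p.2 ∧
    p.1 + α * p.2 ≤ (ℓ : ℤ) + α * ((v : ℤ) + 1) - β
  /-- (Ai) the layers `𝒳(k)` are empty unless `v+1 ≤ k ≤ 2v+1` -/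
  hXvert : ∀ p ∈ X, (v : ℤ) + 1 ≤ p.2 ∧ p.2 ≤ 2 * (v : ℤ) + 1
  /-- (Ai) each layer is an interval of consecutive lattice points -/
  hXint : ∀ x x' x'' k : ℤ, (x, k) ∈ X → (x'', k) ∈ X → x ≤ x' → x' ≤ x'' →
    (x', k) ∈ X
  /-- (Aii) normalisation: if `𝒳 ≠ ∅` then `(ℓ−β, v+1) ∈ 𝒳` -/
  hXnorm : X.Nonempty → ((ℓ : ℤ) - β, (v : ℤ) + 1) ∈ X
  /-- (Aiii) ascending slimness -/
  hXslim : ∀ x k t : ℤ, (v : ℤ) + 1 ≤ k → (x, k + 1) ∈ X → 0 ≤ t → t ≤ α →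
    (x + t, k) ∈ X
  /-- `𝒳(k) ⊆ C(k)` -/
  hXchain : ∀ x k : ℤ, (x, k) ∈ X → a k ≤ x ∧ x ≤ a k + ℓ
  /-- a nonempty `𝒳(k)` is the right-hand end of `C(k)` -/
  hXright : ∀ x k : ℤ, (x, k) ∈ X → (a k + ℓ, k) ∈ X

namespace MesetData

variable {ℓ v : ℕ} {α β : ℤ} (M : MesetData ℓ v α β)

/-- `𝒵 = (⋃_k 𝒴(k)) + (β, −v−1)` where `𝒴(k) = C(k) ∖ 𝒳(k)`. -/
def Z : Set (ℤ × ℤ) :=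
  {p | ∃ x k : ℤ, (v : ℤ) + 1 ≤ k ∧ k ≤ 2 * (v : ℤ) + 1 ∧ M.a k ≤ x ∧
    x ≤ M.a k + ℓ ∧ (x, k) ∉ M.X ∧ p = (x + β, k - (v : ℤ) - 1)}

/-- the maximal exceptional set `cl = 𝒵 ∪ 𝒳` -/
def cl : Set (ℤ × ℤ) := M.Z ∪ M.X

/-- `K_free = {k ∈ {0,…,v} | 𝒳(k+v+1) = ∅}` -/
def Kfree : Set ℤ :=
  {k | 0 ≤ k ∧ k ≤ (v : ℤ) ∧ ∀ x : ℤ, (x, k + (v : ℤ) + 1) ∉ M.X}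

/-- `k₀`, the maximal non-free `k ∈ {0,…,v}` (the top layer of `𝒵_bound`). -/
noncomputable def k0 : ℤ := sSup {k : ℤ | 0 ≤ k ∧ k ≤ (v : ℤ) ∧ k ∉ M.Kfree}

/-- `cl(k)^L` for a free layer `k`. -/
def FreeL (k : ℤ) : ℤ × ℤ := (M.a (k + (v : ℤ) + 1) + β, k)

/-- `cl(k)^R` for a free layer `k`. -/
def FreeR (k : ℤ) : ℤ × ℤ := (M.a (k + (v : ℤ) + 1) + (ℓ : ℤ) + β, k)

/-- `cl(+∞)^L`, the leftmost point of `𝒳(v+1)`. -/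
noncomputable def TopL : ℤ × ℤ := (sInf {x : ℤ | (x, (v : ℤ) + 1) ∈ M.X}, (v : ℤ) + 1)

/-- `cl(+∞)^R = cl(+∞)^L + (ℓ,0)`. -/
noncomputable def TopR : ℤ × ℤ := M.TopL + ((ℓ : ℤ), 0)

/-- `cl(−∞)^R`, the rightmost point of `𝒵_bound ∩ (ℤ×{k₀})`. -/
noncomputable def BotR : ℤ × ℤ :=
  (sInf {x : ℤ | (x, M.k0 + (v : ℤ) + 1) ∈ M.X} - 1 + β, M.k0)

/-- `cl(−∞)^L = cl(−∞)^R − (ℓ,0)`. -/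
noncomputable def BotL : ℤ × ℤ := M.BotR - ((ℓ : ℤ), 0)

/-- the point `cl(k)^L`, for `k ∈ K ⊆ {−∞} ∪ ℤ ∪ {+∞}` -/
noncomputable def Lpt (e : WithBot (WithTop ℤ)) : ℤ × ℤ :=
  WithBot.recBotCoe M.BotL
    (fun t => WithTop.recTopCoe M.TopL (fun k => M.FreeL k) t) e

/-- the point `cl(k)^R`, for `k ∈ K ⊆ {−∞} ∪ ℤ ∪ {+∞}` -/
noncomputable def Rpt (e : WithBot (WithTop ℤ)) : ℤ × ℤ :=
  WithBot.recBotCoe M.BotR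
    (fun t => WithTop.recTopCoe M.TopR (fun k => M.FreeR k) t) e

/-- the index set `K`: the free layers, together with `−∞` and `+∞` if `𝒳 ≠ ∅` -/
def Kset : Set (WithBot (WithTop ℤ)) :=
  {e | ∃ k ∈ M.Kfree, e = ((k : WithTop ℤ) : WithBot (WithTop ℤ))} ∪
    {e | (e = ⊥ ∨ e = ⊤) ∧ M.X.Nonempty}

/-- the layer `cl(k)` is displaced: some `k' < k` in `K` has
`cl(k')^L ≰ cl(k)^L` componentwise -/
def Displaced (k : WithBot (WithTop ℤ)) : Prop :=
  ∃ k' ∈ M.Kset, k' < k ∧ ¬ M.Lpt k' ≤ M.Lpt k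

end MesetData

namespace MesetData

variable {ℓ v : ℕ} {α β : ℤ} (M : MesetData ℓ v α β)

/-- leftmost abscissa of the layer at height `h` -/
noncomputable def sL (h : ℤ) : ℤ := sInf {x : ℤ | (x, h) ∈ M.X}

theorem sL_spec {x h : ℤ} (hx : (x, h) ∈ M.X) : (M.sL h, h) ∈ M.X ∧ M.sL h ≤ x := by
  have hb : BddBelow {x : ℤ | (x, h) ∈ M.X} :=
    ⟨M.a h, fun y hy => (M.hXchain y h hy).1⟩
  exact ⟨Int.csInf_mem ⟨x, hx⟩ hb, csInf_le hb hx⟩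

theorem slim_iter (hα : 0 ≤ α) (h : ℤ) (hh : (v : ℤ) + 1 ≤ h) (n : ℕ) :
    ∀ x : ℤ, (x, h + n) ∈ M.X → (x, h) ∈ M.X ∧ (x + α * n, h) ∈ M.X := by
  induction n with
  | zero => intro x hx; simpa using hx
  | succ n ih =>
    intro x hx
    have e : h + ((n + 1 : ℕ) : ℤ) = (h + n) + 1 := by push_cast; ring
    rw [e] at hx
    have h1 := M.hXslim x (h + n) 0 (by omega) hx le_rfl hα
    have h2 := M.hXslim x (h + n) α (by omega) hx hα le_rfl
    refine ⟨?_, ?_⟩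
    · simpa using (ih _ h1).1
    · have := (ih _ h2).2
      have e : x + α * ((n + 1 : ℕ) : ℤ) = x + α + α * n := by push_cast; ring
      rw [e]; exact this

theorem slim_le (hα : 0 ≤ α) {h h' x : ℤ} (hh : (v : ℤ) + 1 ≤ h) (hle : h ≤ h')
    (hx : (x, h') ∈ M.X) : (x, h) ∈ M.X ∧ (x + α * (h' - h), h) ∈ M.X := by
  obtain ⟨n, hn⟩ := Int.eq_ofNat_of_zero_le (show 0 ≤ h' - h by omega)
  have e : h' = h + n := by omega
  rw [hn]
  rw [e] at hx
  exact M.slim_iter hα h hh n x hx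

theorem k0_spec (hX : M.X.Nonempty) :
    0 ≤ M.k0 ∧ M.k0 ≤ v ∧ (∃ x, (x, M.k0 + (v : ℤ) + 1) ∈ M.X) ∧
      ∀ k x : ℤ, (x, k + (v : ℤ) + 1) ∈ M.X → k ≤ M.k0 := by
  have hn := M.hXnorm hX
  have hb : BddAbove {k : ℤ | 0 ≤ k ∧ k ≤ (v : ℤ) ∧ k ∉ M.Kfree} := ⟨v, fun y hy => hy.2.1⟩
  have hne : {k : ℤ | 0 ≤ k ∧ k ≤ (v : ℤ) ∧ k ∉ M.Kfree}.Nonempty := by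
    refine ⟨0, le_rfl, by omega, fun hf => hf.2.2 (ℓ - β) ?_⟩
    simpa using hn
  have hm : M.k0 ∈ _ := Int.csSup_mem hne hb
  refine ⟨hm.1, hm.2.1, ?_, ?_⟩
  · by_contra hcon
    push Not at hcon
    exact hm.2.2 ⟨hm.1, hm.2.1, hcon⟩
  · intro k x hx
    have := M.hXvert _ hx
    simp only at this
    exact le_csSup hb ⟨by omega, by omega, fun hf => hf.2.2 x hx⟩

theorem free_gt (hα : 0 ≤ α) {k : ℤ} (hX : M.X.Nonempty) (hk : k ∈ M.Kfree) : M.k0 < k := by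
  obtain ⟨h0, h1, ⟨x, hx⟩, _⟩ := M.k0_spec hX
  by_contra hcon
  exact hk.2.2 x (M.slim_le hα (by linarith [hk.1]) (by omega) hx).1

theorem mem_Kset_iff (e : WithBot (WithTop ℤ)) : e ∈ M.Kset ↔
    (∃ k ∈ M.Kfree, e = ((k : WithTop ℤ) : WithBot (WithTop ℤ))) ∨
    (e = ⊥ ∧ M.X.Nonempty) ∨ (e = ⊤ ∧ M.X.Nonempty) := by
  unfold Kset
  simp only [Set.mem_union, Set.mem_ofPred_eq]
  rw [or_and_right]

/-- explicit inequalities expressing that no layer is displaced -/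
def Good : Prop :=
  (∀ k ∈ M.Kfree, ∀ k' ∈ M.Kfree, k < k' → M.a (k + v + 1) ≤ M.a (k' + v + 1)) ∧
  (M.X.Nonempty →
    (∀ k ∈ M.Kfree, M.sL (M.k0 + v + 1) - 1 - ℓ ≤ M.a (k + v + 1)) ∧
    (∀ k ∈ M.Kfree, M.a (k + v + 1) + β ≤ M.sL (v + 1)) ∧
    M.sL (M.k0 + v + 1) - 1 + β - ℓ ≤ M.sL (v + 1))

theorem lt_top_coe (k : ℤ) : (((k : WithTop ℤ) : WithBot (WithTop ℤ))) < ⊤ := by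
  rw [← WithBot.coe_top, WithBot.coe_lt_coe]; exact WithTop.coe_lt_top k

theorem Lpt_coe (k : ℤ) : M.Lpt ((k : WithTop ℤ) : WithBot (WithTop ℤ)) =
    (M.a (k + (v : ℤ) + 1) + β, k) := rfl

theorem Lpt_bot : M.Lpt ⊥ = (M.sL (M.k0 + v + 1) - 1 + β - ℓ, M.k0) := by
  show M.BotL = _
  simp [BotL, BotR, sL]

theorem Lpt_top : M.Lpt ⊤ = (M.sL (v + 1), (v : ℤ) + 1) := rfl

/-- strict monotonicity of heights -/
theorem height_lt (hα : 0 ≤ α) {e e' : WithBot (WithTop ℤ)} (he : e ∈ M.Kset) (he' : e' ∈ M.Kset)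
    (hlt : e < e') : (M.Lpt e).2 < (M.Lpt e').2 := by
  rw [mem_Kset_iff] at he he'
  rcases he with ⟨k, hk, rfl⟩ | ⟨rfl, hX⟩ | ⟨rfl, hX⟩ <;>
  rcases he' with ⟨k', hk', rfl⟩ | ⟨rfl, hX'⟩ | ⟨rfl, hX'⟩
  · rw [WithBot.coe_lt_coe, WithTop.coe_lt_coe] at hlt
    exact hlt
  · simp at hlt
  · rw [Lpt_coe, Lpt_top]; have := hk.2.1; simp only; omega
  · rw [Lpt_coe, Lpt_bot]; exact M.free_gt hα hX hk'
  · simp at hlt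
  · rw [Lpt_bot, Lpt_top]; have := (M.k0_spec hX).2.1; simp only; omega
  · simp at hlt
  · simp at hlt
  · simp at hlt

theorem good_iff_mono (hα : 0 ≤ α) : M.Good ↔
    ∀ e' ∈ M.Kset, ∀ e ∈ M.Kset, e < e' → M.Lpt e ≤ M.Lpt e' := by
  have hF : ∀ k ∈ M.Kfree, ((k : WithTop ℤ) : WithBot (WithTop ℤ)) ∈ M.Kset :=
    fun k hk => (M.mem_Kset_iff _).2 (Or.inl ⟨k, hk, rfl⟩)
  have hB : M.X.Nonempty → ⊥ ∈ M.Kset := fun h => (M.mem_Kset_iff _).2 (Or.inr (Or.inl ⟨rfl, h⟩))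
  have hT : M.X.Nonempty → ⊤ ∈ M.Kset := fun h => (M.mem_Kset_iff _).2 (Or.inr (Or.inr ⟨rfl, h⟩))
  constructor
  · rintro ⟨g1, g2⟩ e' he' e he hlt
    refine ⟨?_, (M.height_lt hα he he' hlt).le⟩
    rw [mem_Kset_iff] at he he'
    rcases he with ⟨k, hk, rfl⟩ | ⟨rfl, hX⟩ | ⟨rfl, hX⟩ <;>
    rcases he' with ⟨k', hk', rfl⟩ | ⟨rfl, hX'⟩ | ⟨rfl, hX'⟩
    · rw [WithBot.coe_lt_coe, WithTop.coe_lt_coe] at hlt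
      have := g1 k hk k' hk' hlt
      simp only [Lpt_coe]; omega
    · simp at hlt
    · have := (g2 hX').2.1 k hk
      simpa only [Lpt_coe, Lpt_top] using this
    · have := (g2 hX).1 k' hk'
      simp only [Lpt_coe, Lpt_bot]; omega
    · simp at hlt
    · have := (g2 hX).2.2
      simpa only [Lpt_bot, Lpt_top] using this
    · simp at hlt
    · simp at hlt
    · simp at hlt
  · intro H
    refine ⟨fun k hk k' hk' hlt => ?_, fun hX => ⟨fun k hk => ?_, fun k hk => ?_, ?_⟩⟩
    · have := (H _ (hF k' hk') _ (hF k hk) (by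
        rw [WithBot.coe_lt_coe, WithTop.coe_lt_coe]; exact hlt)).1
      simp only [Lpt_coe] at this; omega
    · have := (H _ (hF k hk) _ (hB hX) (WithBot.bot_lt_coe _)).1
      simp only [Lpt_coe, Lpt_bot] at this; omega
    · have := (H _ (hT hX) _ (hF k hk) (lt_top_coe k)).1
      simpa only [Lpt_coe, Lpt_top] using this
    · have := (H _ (hT hX) _ (hB hX) bot_lt_top).1
      simpa only [Lpt_bot, Lpt_top] using this

theorem good_iff_nodisp (hα : 0 ≤ α) : M.Good ↔ ∀ k ∈ M.Kset, ¬ M.Displaced k := by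
  rw [M.good_iff_mono hα]
  unfold Displaced
  push Not
  rfl

theorem good_iff_total (hα : 0 ≤ α) : M.Good ↔ ∀ k ∈ M.Kset, ∀ k' ∈ M.Kset,
    M.Lpt k ≤ M.Lpt k' ∨ M.Lpt k' ≤ M.Lpt k := by
  rw [M.good_iff_mono hα]
  constructor
  · intro H k hk k' hk'
    rcases lt_trichotomy k k' with h | h | h
    · exact Or.inl (H _ hk' _ hk h)
    · subst h; exact Or.inl le_rfl
    · exact Or.inr (H _ hk _ hk' h)
  · intro H e' he' e he hlt
    rcases H e he e' he' with h | h
    · exact h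
    · exact absurd h.2 (not_le.2 (M.height_lt hα he he' hlt))

theorem mem_Acyc_iff (p : ℤ × ℤ) : p ∈ Acyc ℓ v α β ↔
    (0 ≤ p.2 → -(ℓ : ℤ) ≤ p.1) ∧
    (p.2 ≤ -(v : ℤ) - 1 → p.1 < β ∧ β - (ℓ : ℤ) - 1 + α * (-(v : ℤ) - 1 - p.2) < p.1) := by
  simp only [Acyc, CHl, CHv, CHlv, Set.mem_compl_iff, Set.mem_union, Set.mem_ofPred_eq]
  constructor
  · intro h
    push Not at h
    refine ⟨fun h1 => ?_, fun h1 => ⟨h.1.2 h1, h.2 h1⟩⟩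
    have := h.1.1 h1; omega
  · rintro ⟨h1, h2⟩
    push Not
    exact ⟨⟨fun h => by have := h1 h; omega, fun h => (h2 h).1⟩, fun h => (h2 h).2⟩

theorem se_imp_good (hα : 0 ≤ α)
    (H : ∀ A ∈ M.cl, ∀ B ∈ M.cl, B - A ∈ Acyc ℓ v α β) : M.Good := by
  have hF : ∀ k ∈ M.Kfree, ∀ x, M.a (k + v + 1) ≤ x → x ≤ M.a (k + v + 1) + ℓ →
      (x + β, k) ∈ M.cl := fun k hk x h1 h2 =>
    Or.inl ⟨x, k + v + 1, by have := hk.1; omega, by have := hk.2.1; omega, h1, h2, hk.2.2 x,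
      by congr 1; ring⟩
  have key : ∀ x y k k' : ℤ, (x, k) ∈ M.cl → (y, k') ∈ M.cl → k ≤ k' → -(ℓ : ℤ) ≤ y - x := by
    intro x y k k' h1 h2 hle
    have := ((mem_Acyc_iff _).1 (H _ h1 _ h2)).1
    simp only [Prod.mk_sub_mk] at this
    exact this (by omega)
  have hT : M.X.Nonempty → (M.sL (v + 1), (v : ℤ) + 1) ∈ M.cl := fun hX =>
    Or.inr (M.sL_spec (M.hXnorm hX)).1
  have hB : M.X.Nonempty → (M.sL (M.k0 + v + 1) - 1 + β, M.k0) ∈ M.cl := by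
    intro hX
    obtain ⟨h0, h1, ⟨x, hx⟩, _⟩ := M.k0_spec hX
    obtain ⟨hs, _⟩ := M.sL_spec hx
    have b1 := M.hXsub _ hs
    have b2 := M.hXsub _ (M.hXright _ _ hs)
    have b3 := M.hXchain _ _ hs
    simp only at b1 b2
    have : 0 ≤ α * M.k0 := mul_nonneg hα h0
    have b4 : M.a (M.k0 + v + 1) ≤ -β := by nlinarith [b2.2.2]
    refine Or.inl ⟨M.sL (M.k0 + v + 1) - 1, M.k0 + v + 1, by omega, by omega, by omega, by omega,
      fun hc => ?_, by congr 1; ring⟩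
    have := (M.sL_spec hc).2
    omega
  refine ⟨fun k hk k' hk' hlt => ?_, fun hX => ⟨fun k hk => ?_, fun k hk => ?_, ?_⟩⟩
  · have := key _ _ _ _ (hF k hk (M.a (k + v + 1) + ℓ) (by omega) le_rfl)
      (hF k' hk' _ le_rfl (by omega)) hlt.le
    omega
  · have := key _ _ _ _ (hB hX) (hF k hk _ le_rfl (by omega)) (M.free_gt hα hX hk).le
    omega
  · have := key _ _ _ _ (hF k hk (M.a (k + v + 1) + ℓ) (by omega) le_rfl) (hT hX)
      (by have := hk.2.1; omega)
    omega
  · have := key _ _ _ _ (hB hX) (hT hX) (by have := (M.k0_spec hX).2.1; omega)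
    omega

/-- points of `Z`, in a convenient form: free or bound -/
theorem Z_cases {p : ℤ × ℤ} (hp : p ∈ M.Z) : 0 ≤ p.2 ∧ p.2 ≤ v ∧
    M.a (p.2 + v + 1) + β ≤ p.1 ∧ p.1 ≤ M.a (p.2 + v + 1) + ℓ + β ∧
    (p.2 ∈ M.Kfree ∨ (∃ x, (x, p.2 + (v : ℤ) + 1) ∈ M.X)) ∧
    ∀ x, (x, p.2 + (v : ℤ) + 1) ∈ M.X → p.1 - β < x := by
  obtain ⟨x, k, h1, h2, h3, h4, h5, rfl⟩ := hp
  have e : k - (v : ℤ) - 1 + v + 1 = k := by ring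
  simp only [e]
  refine ⟨by omega, by omega, by omega, by omega, ?_, ?_⟩
  · by_cases hc : ∃ x, (x, k) ∈ M.X
    · exact Or.inr hc
    · push Not at hc
      exact Or.inl ⟨by omega, by omega, by simpa only [e] using hc⟩
  · intro y hy
    by_contra hcon
    exact h5 (M.hXint y x _ k hy (M.hXright _ _ hy) (by omega) h4)

theorem good_imp_se (hα : 0 ≤ α) (G : M.Good) :
    ∀ A ∈ M.cl, ∀ B ∈ M.cl, B - A ∈ Acyc ℓ v α β := by
  obtain ⟨g1, g2⟩ := G
  rintro ⟨x, k⟩ hA ⟨y, k'⟩ hB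
  rw [mem_Acyc_iff]
  simp only [Prod.mk_sub_mk]
  rcases hA with hA | hA <;> rcases hB with hB | hB
  · obtain ⟨a1, a2, a3, a4, a5, a6⟩ := M.Z_cases hA
    obtain ⟨b1, b2, b3, b4, b5, b6⟩ := M.Z_cases hB
    simp only at a1 a2 a3 a4 a5 a6 b1 b2 b3 b4 b5 b6
    refine ⟨fun hj => ?_, fun hj => by omega⟩
    rcases b5 with b5 | ⟨z, hz⟩
    · rcases a5 with a5 | ⟨w, hw⟩
      · rcases eq_or_lt_of_le (show k ≤ k' by omega) with h | h
        · subst h; omega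
        · have := g1 k a5 k' b5 h
          omega
      · have hX : M.X.Nonempty := ⟨_, hw⟩
        have := (g2 hX).1 _ b5
        obtain ⟨h0, h1, ⟨u, hu⟩, hmax⟩ := M.k0_spec hX
        have := hmax k w hw
        have := a6 _ (M.slim_le hα (by omega) (by omega) (M.sL_spec hu).1).1
        omega
    · have hr := M.hXright _ _ hz
      have := a6 _ (M.slim_le hα (by omega) (by omega) hr).1
      omega
  · have hX : M.X.Nonempty := ⟨_, hB⟩
    obtain ⟨a1, a2, a3, a4, a5, a6⟩ := M.Z_cases hA
    simp only at a1 a2 a3 a4 a5 a6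
    have hv := M.hXvert _ hB
    simp only at hv
    refine ⟨fun hj => ?_, fun hj => by omega⟩
    have hy := (M.sL_spec (M.slim_le hα le_rfl hv.1 hB).1).2
    rcases a5 with a5 | ⟨w, hw⟩
    · have := (g2 hX).2.1 _ a5
      omega
    · have := (g2 hX).2.2
      obtain ⟨h0, h1, ⟨u, hu⟩, hmax⟩ := M.k0_spec hX
      have := hmax k w hw
      have := a6 _ (M.slim_le hα (by omega) (by omega) (M.sL_spec hu).1).1
      omega
  · obtain ⟨b1, b2, b3, b4, b5, b6⟩ := M.Z_cases hB
    simp only at b1 b2 b3 b4 b5 b6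
    have hv := M.hXvert _ hA
    simp only at hv
    refine ⟨fun hj => by omega, fun hj => ?_⟩
    obtain ⟨c1, c2⟩ := M.slim_le hα (show (v : ℤ) + 1 ≤ k' + v + 1 by omega)
      (show k' + v + 1 ≤ k by omega) hA
    have := b6 _ c1
    have := (M.hXchain _ _ c2).2
    have e : -(v : ℤ) - 1 - (k' - k) = k - (k' + v + 1) := by ring
    rw [e]
    constructor <;> omega
  · have hv := M.hXvert _ hA
    have hv' := M.hXvert _ hB
    simp only at hv hv'
    refine ⟨fun hj => ?_, fun hj => by omega⟩
    have h1 := M.hXchain _ _ (M.slim_le hα le_rfl hv.1 hA).1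
    have h2 := M.hXchain _ _ (M.slim_le hα le_rfl hv'.1 hB).1
    omega

end MesetData

/-- Theorem B, toric case: a maximal exceptional set `cl` on
`X(ℓ,v;c)` is strongly exceptional iff no layer is displaced, equivalently iff
`{cl(k)^L | k ∈ K}` is totally ordered by the componentwise order. -/
theorem stronglyExceptional_iff_no_displaced
    (ℓ v : ℕ) (hℓ : 1 ≤ ℓ) (hv : 1 ≤ v) (c : Fin v → ℤ)
    (hc0 : c ⟨0, by omega⟩ ≤ 0) (hc : Antitone c)
    (α β : ℤ) (hα : α = -c ⟨v - 1, by omega⟩) (hβ : β = -(∑ i, c i))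
    (M : MesetData ℓ v α β) :
    ((∀ A ∈ M.cl, ∀ B ∈ M.cl, B - A ∈ Acyc ℓ v α β) ↔
        ∀ k ∈ M.Kset, ¬ M.Displaced k) ∧
    ((∀ A ∈ M.cl, ∀ B ∈ M.cl, B - A ∈ Acyc ℓ v α β) ↔
        ∀ k ∈ M.Kset, ∀ k' ∈ M.Kset,
          M.Lpt k ≤ M.Lpt k' ∨ M.Lpt k' ≤ M.Lpt k) := by
  have hα0 : 0 ≤ α := by
    have : c ⟨v - 1, by omega⟩ ≤ c ⟨0, by omega⟩ := hc (Fin.mk_le_mk.2 (Nat.zero_le _))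
    omega
  have hG : (∀ A ∈ M.cl, ∀ B ∈ M.cl, B - A ∈ Acyc ℓ v α β) ↔ M.Good :=
    ⟨M.se_imp_good hα0, M.good_imp_se hα0⟩
  exact ⟨hG.trans (M.good_iff_nodisp hα0), hG.trans (M.good_iff_total hα0)⟩
end

section
/- Let cl = 𝒵 ∪ 𝒳 ⊆ ℤ² be a maximal exceptional set on the toric variety X(ℓ,v;c), constructed as in the context. Then cl is effective (i.e. for every pair (A,B) ∈ cl × cl with A − B ∉ −Imm one has B − A ∈ Eff := CH0) if and only if no layer cl(k), k ∈ K, is bad. -/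
/-- The immaculate locus of `X(ℓ,v;c)`. -/
def Imm (ℓ v : ℕ) (α β : ℤ) : Set (ℤ × ℤ) :=
  (CH0 α ∪ CHl ℓ ∪ CHv v β ∪ CHlv ℓ v α β)ᶜ

/-- `-Imm`. -/
def negImm (ℓ v : ℕ) (α β : ℤ) : Set (ℤ × ℤ) := {p | -p ∈ Imm ℓ v α β}

namespace MesetData

variable {ℓ v : ℕ} {α β : ℤ} (M : MesetData ℓ v α β)

/-- the layer `cl(k)` is bad: some `k' < k` in `K` has `cl(k')^L ≰ cl(k)^L`
componentwise and `cl(k)^L − cl(k')^R ∉ Eff` -/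
noncomputable def Bad (α : ℤ) (k : WithBot (WithTop ℤ)) : Prop :=
  ∃ k' ∈ M.Kset, k' < k ∧ ¬ M.Lpt k' ≤ M.Lpt k ∧ M.Lpt k - M.Rpt k' ∉ CH0 α

end MesetData

namespace MesetData

variable {ℓ v : ℕ} {α β : ℤ} (M : MesetData ℓ v α β)

theorem aux_down0 (hα : 0 ≤ α) (n : ℕ) : ∀ x k : ℤ, (v : ℤ) + 1 ≤ k → (x, k + n) ∈ M.X →
    (x, k) ∈ M.X := by
  induction n with
  | zero => intro x k _ h; simpa using h
  | succ n ih =>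
    intro x k hk h
    apply ih x k hk
    have h2 := M.hXslim x (k + n) 0 (by omega) (by
      convert h using 2; push_cast; ring) le_rfl hα
    simpa using h2

theorem aux_down1 (hα : 0 ≤ α) (n : ℕ) : ∀ x k : ℤ, (v : ℤ) + 1 ≤ k → (x, k + n) ∈ M.X →
    (x + α * n, k) ∈ M.X := by
  induction n with
  | zero => intro x k _ h; simpa using h
  | succ n ih =>
    intro x k hk h
    have h2 := M.hXslim x (k + n) α (by omega) (by
      convert h using 2; push_cast; ring) hα le_rfl
    have h3 := ih (x + α) k hk h2
    convert h3 using 2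
    push_cast; ring

theorem down0 (hα : 0 ≤ α) {x k h : ℤ} (hh : (v : ℤ) + 1 ≤ h) (hk : h ≤ k)
    (hx : (x, k) ∈ M.X) : (x, h) ∈ M.X := by
  apply M.aux_down0 hα (k - h).toNat x h hh
  have : h + ((k - h).toNat : ℤ) = k := by omega
  rwa [this]

theorem down1 (hα : 0 ≤ α) {x k h : ℤ} (hh : (v : ℤ) + 1 ≤ h) (hk : h ≤ k)
    (hx : (x, k) ∈ M.X) : (x + α * (k - h), h) ∈ M.X := by
  have h1 : ((k - h).toNat : ℤ) = k - h := by omega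
  have := M.aux_down1 hα (k - h).toNat x h hh (by
    rw [h1]; convert hx using 2; ring)
  rwa [h1] at this

theorem inf_le {y k : ℤ} (h : (y, k) ∈ M.X) : sInf {x : ℤ | (x, k) ∈ M.X} ≤ y :=
  csInf_le ⟨M.a k, fun x hx => (M.hXchain x k hx).1⟩ h

theorem inf_mem {y k : ℤ} (h : (y, k) ∈ M.X) : (sInf {x : ℤ | (x, k) ∈ M.X}, k) ∈ M.X :=
  Int.csInf_mem (s := {x : ℤ | (x, k) ∈ M.X}) ⟨y, h⟩
    ⟨M.a k, fun x hx => (M.hXchain x k hx).1⟩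

theorem le_k0 {k : ℤ} (h0 : 0 ≤ k) (h1 : k ≤ v) (h : k ∉ M.Kfree) : k ≤ M.k0 :=
  le_csSup (s := {k : ℤ | 0 ≤ k ∧ k ≤ (v : ℤ) ∧ k ∉ M.Kfree})
    ⟨v, fun _ hx => hx.2.1⟩ ⟨h0, h1, h⟩

theorem k0_mem (hX : M.X.Nonempty) : 0 ≤ M.k0 ∧ M.k0 ≤ (v : ℤ) ∧ M.k0 ∉ M.Kfree := by
  have : M.k0 ∈ {k : ℤ | 0 ≤ k ∧ k ≤ (v : ℤ) ∧ k ∉ M.Kfree} := by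
    apply Int.csSup_mem
    · refine ⟨0, le_rfl, by positivity, fun h => h.2.2 (ℓ - β) ?_⟩
      simpa using M.hXnorm hX
    · exact ⟨v, fun _ hx => hx.2.1⟩
  exact this

theorem ex_of_not_free {k : ℤ} (h0 : 0 ≤ k) (h1 : k ≤ v) (h : k ∉ M.Kfree) :
    ∃ x, (x, k + (v : ℤ) + 1) ∈ M.X := by
  by_contra hc
  push Not at hc
  exact h ⟨h0, h1, hc⟩

theorem not_free_of_le (hα : 0 ≤ α) (hX : M.X.Nonempty) {k : ℤ} (h1 : k ≤ M.k0) :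
    k ∉ M.Kfree := by
  intro h
  obtain ⟨h0, hv, hf⟩ := M.k0_mem hX
  obtain ⟨x, hx⟩ := M.ex_of_not_free h0 hv hf
  exact h.2.2 x (M.down0 hα (by have := h.1; omega) (by omega) hx)

theorem Z_cases_s1 (hα : 0 ≤ α) {A : ℤ × ℤ} (hA : A ∈ M.Z) :
    (A.2 ∈ M.Kfree ∧ (M.FreeL A.2).1 ≤ A.1 ∧ A.1 ≤ (M.FreeR A.2).1) ∨
    (M.X.Nonempty ∧ 0 ≤ A.2 ∧ A.2 ≤ (v : ℤ) ∧ A.2 ≤ M.k0 ∧ A.1 ≤ M.BotR.1 ∧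
      (M.a (A.2 + (v : ℤ) + 1) + ℓ, A.2 + (v : ℤ) + 1) ∈ M.X ∧
      M.a (A.2 + (v : ℤ) + 1) + β ≤ A.1 ∧
      ∀ y, (y, A.2 + (v : ℤ) + 1) ∈ M.X → A.1 < y + β) := by
  obtain ⟨x, k, hk1, hk2, ha1, ha2, hx, rfl⟩ := hA
  have hkk : k - (v : ℤ) - 1 + v + 1 = k := by ring
  by_cases hf : k - (v : ℤ) - 1 ∈ M.Kfree
  · left
    refine ⟨hf, ?_, ?_⟩
    · simp only [FreeL, hkk]; omega
    · simp only [FreeR, hkk]; omega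
  · right
    obtain ⟨y, hy⟩ := M.ex_of_not_free (by omega) (by omega) hf
    have hX : M.X.Nonempty := ⟨_, hy⟩
    have hr := M.hXright _ _ hy
    have hk0 := M.le_k0 (by omega) (by omega) hf
    simp only [hkk] at hy hr ⊢
    have hlt : ∀ y, (y, k) ∈ M.X → x + β < y + β := by
      intro y hy
      by_contra hc
      exact hx (M.hXint y x _ k hy hr (by omega) ha2)
    refine ⟨hX, by omega, by omega, hk0, ?_, hr, by omega, hlt⟩
    obtain ⟨h0, hv, hf0⟩ := M.k0_mem hX
    obtain ⟨z, hz⟩ := M.ex_of_not_free h0 hv hf0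
    have hm := M.inf_mem hz
    have := hlt _ (M.down0 hα hk1 (by omega) hm)
    simp only [BotR]
    omega

theorem X_ge (hα : 0 ≤ α) {A : ℤ × ℤ} (hA : A ∈ M.X) : M.TopL.1 ≤ A.1 ∧ M.TopL.2 ≤ A.2 := by
  obtain ⟨x, k⟩ := A
  have h := M.hXvert _ hA
  exact ⟨M.inf_le (M.down0 hα le_rfl h.1 hA), h.1⟩

theorem FreeL_mem {k : ℤ} (hk : k ∈ M.Kfree) : M.FreeL k ∈ M.cl :=
  Or.inl ⟨M.a (k + v + 1), k + v + 1, by have := hk.1; omega, by have := hk.2.1; omega,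
    le_rfl, by omega, hk.2.2 _, by simp only [FreeL]; congr 1; ring⟩

theorem FreeR_mem {k : ℤ} (hk : k ∈ M.Kfree) : M.FreeR k ∈ M.cl :=
  Or.inl ⟨M.a (k + v + 1) + ℓ, k + v + 1, by have := hk.1; omega, by have := hk.2.1; omega,
    by omega, le_rfl, hk.2.2 _, by simp only [FreeR]; congr 1; ring⟩

theorem TopL_mem (hX : M.X.Nonempty) : M.TopL ∈ M.cl :=
  Or.inr (M.inf_mem (M.hXnorm hX))

theorem BotR_mem (hα : 0 ≤ α) (hX : M.X.Nonempty) : M.BotR ∈ M.cl := by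
  obtain ⟨h0, hv, hf0⟩ := M.k0_mem hX
  obtain ⟨z, hz⟩ := M.ex_of_not_free h0 hv hf0
  have hm := M.inf_mem hz
  have hr := M.hXright _ _ hz
  have hc := M.hXchain _ _ hm
  have hb1 := (M.hXsub _ hm).1
  have hb2 := (M.hXsub _ hr).2.2
  have : 0 ≤ α * M.k0 := mul_nonneg hα h0
  simp only at hb1 hb2
  refine Or.inl ⟨sInf {x : ℤ | (x, M.k0 + (v : ℤ) + 1) ∈ M.X} - 1, M.k0 + v + 1,
    by omega, by omega, by nlinarith, by omega, ?_, ?_⟩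
  · intro h
    have := M.inf_le h
    omega
  · simp only [BotR]; congr 1; ring

theorem Lpt_eq (e : WithBot (WithTop ℤ)) : M.Lpt e = M.Rpt e - ((ℓ : ℤ), 0) := by
  induction e using WithBot.recBotCoe with
  | bot => rfl
  | coe t =>
    induction t using WithTop.recTopCoe with
    | top =>
      change M.TopL = M.TopL + ((ℓ : ℤ), 0) - ((ℓ : ℤ), 0)
      simp
    | coe k =>
      simp only [Lpt, Rpt, FreeL, FreeR, WithBot.recBotCoe_coe, WithTop.recTopCoe_coe]
      ext <;> simp <;> ring

/-- key transfer -/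
theorem transfer (hα : 0 ≤ α) (hbad : ∀ k ∈ M.Kset, ¬ M.Bad α k) {A B : ℤ × ℤ}
    {e e' : WithBot (WithTop ℤ)} (he : e ∈ M.Kset) (he' : e' ∈ M.Kset) (hlt : e' < e)
    (hA1 : A.1 ≤ (M.Rpt e').1) (hA2 : A.2 ≤ (M.Rpt e').2)
    (hB1 : (M.Lpt e).1 ≤ B.1) (hB2 : (M.Lpt e).2 ≤ B.2)
    (hd : B - A ∈ CHl ℓ) : B - A ∈ CH0 α := by
  have hd1 := hd.2
  have h := hbad e he
  have h2 : M.Lpt e - M.Rpt e' ∈ CH0 α := by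
    by_contra hc
    refine h ⟨e', he', hlt, ?_, hc⟩
    rw [M.Lpt_eq e']
    intro hle
    have := hle.1
    simp only [Prod.fst_sub] at this hd1
    omega
  obtain ⟨h3, h4⟩ := h2
  simp only [Prod.fst_sub, Prod.snd_sub] at h3 h4
  constructor
  · exact hd.1
  · simp only [Prod.fst_sub, Prod.snd_sub]
    have : α * ((M.Lpt e).2 - (M.Rpt e').2) ≤ α * (B.2 - A.2) :=
      mul_le_mul_of_nonneg_left (by omega) hα
    linarith

theorem Kset_free {k : ℤ} (hk : k ∈ M.Kfree) :
    ((k : WithTop ℤ) : WithBot (WithTop ℤ)) ∈ M.Kset := Or.inl ⟨k, hk, rfl⟩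
theorem Kset_bot (hX : M.X.Nonempty) : ⊥ ∈ M.Kset := Or.inr ⟨Or.inl rfl, hX⟩
theorem Kset_top (hX : M.X.Nonempty) : ⊤ ∈ M.Kset := Or.inr ⟨Or.inr rfl, hX⟩

theorem caseCHl (hα : 0 ≤ α) (hbad : ∀ k ∈ M.Kset, ¬ M.Bad α k) {A B : ℤ × ℤ}
    (hA : A ∈ M.cl) (hB : B ∈ M.cl) (hd : B - A ∈ CHl ℓ) : B - A ∈ CH0 α := by
  have hd' := hd
  obtain ⟨hd2, hd1⟩ := hd'
  simp only [Prod.fst_sub, Prod.snd_sub] at hd1 hd2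
  rcases hA with hA | hA
  · rcases hB with hB | hB
    · rcases M.Z_cases_s1 hα hA with ⟨hAf, hA1, hA2⟩ | ⟨hX, hA0, hAv, hAk, hAR, hAX, hAa, hAy⟩
      · rcases M.Z_cases_s1 hα hB with ⟨hBf, hB1, hB2⟩ | ⟨hX, hB0, hBv, hBk, hBR, hBX, hBa, hBy⟩
        · by_cases heq : A.2 = B.2
          · simp only [FreeL, FreeR, heq] at *
            omega
          · refine M.transfer hα hbad (M.Kset_free hBf) (M.Kset_free hAf) ?_ hA2 ?_ hB1 ?_ hd
            · rw [WithBot.coe_lt_coe, WithTop.coe_lt_coe]; omega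
            · exact le_rfl
            · exact le_rfl
        · exact absurd hAf (M.not_free_of_le hα hX (by omega))
      · rcases M.Z_cases_s1 hα hB with ⟨hBf, hB1, hB2⟩ | ⟨hX, hB0, hBv, hBk, hBR, hBX, hBa, hBy⟩
        · exact M.transfer hα hbad (M.Kset_free hBf) (M.Kset_bot hX) (WithBot.bot_lt_coe _)
            hAR hAk hB1 le_rfl hd
        · have := hAy _ (M.down0 hα (by omega) (by omega) hBX)
          omega
    · have hX : M.X.Nonempty := ⟨_, hB⟩
      obtain ⟨hB1, hB2⟩ := M.X_ge hα hB
      rcases M.Z_cases_s1 hα hA with ⟨hAf, hA1, hA2⟩ | ⟨-, hA0, hAv, hAk, hAR, hAX, hAa, hAy⟩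
      · exact M.transfer hα hbad (M.Kset_top hX) (M.Kset_free hAf)
          (WithBot.coe_lt_coe.2 (WithTop.coe_lt_top _)) hA2 le_rfl hB1 hB2 hd
      · exact M.transfer hα hbad (M.Kset_top hX) (M.Kset_bot hX)
          (WithBot.bot_lt_coe _) hAR hAk hB1 hB2 hd
  · have hA2 := M.hXvert _ hA
    rcases hB with hB | hB
    · obtain ⟨x, k, hk1, hk2, ha1, ha2, hx, rfl⟩ := hB
      simp only at hd2
      omega
    · obtain ⟨x, h⟩ := A
      obtain ⟨y, k⟩ := B
      simp only at *
      have h1 := M.hXchain _ _ (M.down0 hα hA2.1 (by omega) hB)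
      have h2 := M.hXchain _ _ hA
      omega

theorem case2 (hα : 0 ≤ α) {A B : ℤ × ℤ}
    (hA : A ∈ M.cl) (hB : B ∈ M.cl) (hd : B.2 - A.2 ≤ -(v : ℤ) - 1) :
    B.1 - A.1 < β ∧ β - (ℓ : ℤ) - 1 + α * (-(v : ℤ) - 1 - (B.2 - A.2)) < B.1 - A.1 := by
  rcases hB with hB | hB
  swap
  · have hB2 := M.hXvert _ hB
    rcases hA with hA | hA
    · obtain ⟨x, k, hk1, hk2, ha1, ha2, hx, rfl⟩ := hA
      simp only at hd
      omega
    · have := M.hXvert _ hA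
      omega
  rcases hA with hA | hA
  · obtain ⟨x, k, hk1, hk2, ha1, ha2, hx, rfl⟩ := hA
    obtain ⟨x, k, hk1, hk2, ha1, ha2, hx, rfl⟩ := hB
    simp only at hd
    omega
  · have hA2 := M.hXvert _ hA
    obtain ⟨x, h, hk1, hk2, ha1, ha2, hx, rfl⟩ := hB
    obtain ⟨y, k⟩ := A
    simp only at *
    have hyh := M.down0 hα hk1 (by omega) hA
    have hrh := M.hXright _ _ hyh
    have h1 := M.hXchain _ _ (M.down1 hα hk1 (by omega) hA)
    constructor
    · by_contra hc
      exact hx (M.hXint y x _ h hyh hrh (by omega) ha2)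
    · have : α * (-(v : ℤ) - 1 - (h - v - 1 - k)) = α * (k - h) := by ring
      rw [this]
      linarith [h1.2]

theorem Rpt_mem (hα : 0 ≤ α) {e : WithBot (WithTop ℤ)} (he : e ∈ M.Kset) (ht : e ≠ ⊤) :
    M.Rpt e ∈ M.cl := by
  rcases he with ⟨k, hk, rfl⟩ | ⟨rfl | rfl, hX⟩
  · exact M.FreeR_mem hk
  · exact M.BotR_mem hα hX
  · exact absurd rfl ht

theorem Lpt_mem {e : WithBot (WithTop ℤ)} (he : e ∈ M.Kset) (ht : e ≠ ⊥) :
    M.Lpt e ∈ M.cl := by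
  rcases he with ⟨k, hk, rfl⟩ | ⟨rfl | rfl, hX⟩
  · exact M.FreeL_mem hk
  · exact absurd rfl ht
  · exact M.TopL_mem hX

theorem height (hα : 0 ≤ α) {e e' : WithBot (WithTop ℤ)} (he : e ∈ M.Kset) (he' : e' ∈ M.Kset)
    (hlt : e' < e) : (M.Rpt e').2 ≤ (M.Lpt e).2 := by
  rcases he with ⟨k, hk, rfl⟩ | ⟨rfl | rfl, hX⟩
  · rcases he' with ⟨k', hk', rfl⟩ | ⟨rfl | rfl, hX'⟩
    · rw [WithBot.coe_lt_coe, WithTop.coe_lt_coe] at hlt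
      exact hlt.le
    · change M.k0 ≤ k
      by_contra hc
      exact M.not_free_of_le hα hX' (by omega) hk
    · exact absurd hlt not_top_lt
  · exact absurd hlt not_lt_bot
  · rcases he' with ⟨k', hk', rfl⟩ | ⟨rfl | rfl, hX'⟩
    · change k' ≤ (v : ℤ) + 1
      have := hk'.2.1
      omega
    · change M.k0 ≤ (v : ℤ) + 1
      have := (M.k0_mem hX').2.1
      omega
    · exact absurd hlt (lt_irrefl _)

end MesetData

/-- Proposition 5.7: a maximal exceptional set `cl` on `X(ℓ,v;c)`
is effective if and only if no layer is bad. -/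
theorem effective_iff_no_bad
    (ℓ v : ℕ) (hℓ : 1 ≤ ℓ) (hv : 1 ≤ v) (c : Fin v → ℤ)
    (hc0 : c ⟨0, by omega⟩ ≤ 0) (hc : Antitone c)
    (α β : ℤ) (hα : α = -c ⟨v - 1, by omega⟩) (hβ : β = -(∑ i, c i))
    (M : MesetData ℓ v α β) :
    ((∀ A ∈ M.cl, ∀ B ∈ M.cl, A - B ∉ negImm ℓ v α β → B - A ∈ CH0 α) ↔
      ∀ k ∈ M.Kset, ¬ M.Bad α k) := by
  have hα0 : 0 ≤ α := by
    have : c ⟨v - 1, by omega⟩ ≤ c ⟨0, by omega⟩ := hc (by simp [Fin.le_def])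
    omega
  have hneg : ∀ A B : ℤ × ℤ, A - B ∉ negImm ℓ v α β ↔
      (((B - A ∈ CH0 α ∨ B - A ∈ CHl ℓ) ∨ B - A ∈ CHv v β) ∨ B - A ∈ CHlv ℓ v α β) := by
    intro A B
    simp only [negImm, Imm, Set.mem_setOf_eq, neg_sub, Set.mem_compl_iff, not_not, Set.mem_union]
  constructor
  · rintro heff e he ⟨e', he', hlt, hle, hn⟩
    apply hn
    have hh := M.height hα0 he he' hlt
    refine heff _ (M.Rpt_mem hα0 he' hlt.ne_top) _ (M.Lpt_mem he hlt.ne_bot) ?_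
    rw [hneg]
    refine Or.inl (Or.inl (Or.inr ⟨by simp only [Prod.snd_sub]; omega, ?_⟩))
    by_contra hc
    apply hle
    rw [M.Lpt_eq e']
    simp only [Prod.fst_sub] at hc
    refine ⟨?_, ?_⟩
    · simp only [Prod.fst_sub]; omega
    · simp only [Prod.snd_sub]; omega
  · intro hbad A hA B hB h
    rw [hneg] at h
    rcases h with ((h | h) | h) | h
    · exact h
    · exact M.caseCHl hα0 hbad hA hB h
    · have := M.case2 hα0 hA hB h.1
      exact absurd h.2 (not_le.2 this.1)
    · have := M.case2 hα0 hA hB h.1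
      exact absurd h.2 (not_le.2 this.2)
end

section
/- Every maximal exceptional sequence on X₂, that is, every exceptional sequence (L₁,…,L₆) of length 6 in ℤ² with respect to Imm₂, can be transformed by finitely many applications of right helixing, left helixing, and orthogonal swaps into an exceptional sequence that is either vertically lex ordered or horizontally lex ordered. -/
/-- The immaculate locus of `X₂ = P(Ω_{P²}(−1))` in `Pic(X₂) ≅ ℤ²`. -/
def Imm2 : Set (ℤ × ℤ) :=
  {p | p.2 = -1} ∪ {p | p.1 = -1} ∪ {p | p.1 + p.2 = -2}

/-- `-Imm₂`. -/
def negImm2 : Set (ℤ × ℤ) := {p | -p ∈ Imm2}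

/-- `(L₁,…,L₆)` is an exceptional sequence: `L_a − L_b ∈ Imm₂` for `a < b`. -/
def IsExcSeq2 (L : Fin 6 → ℤ × ℤ) : Prop :=
  ∀ i j : Fin 6, i < j → L i - L j ∈ Imm2

/-- Right helixing (canonical class `K = (−2,−2)`):
`(L₁,…,L₆) ↦ (L₂,…,L₆, L₁+(2,2))`. -/
def helixR2 (L : Fin 6 → ℤ × ℤ) : Fin 6 → ℤ × ℤ := fun i =>
  if h : (i : ℕ) < 5 then L ⟨(i : ℕ) + 1, by omega⟩ else L 0 + (2, 2)

/-- Left helixing: `(L₁,…,L₆) ↦ (L₆−(2,2), L₁,…,L₅)`. -/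
def helixL2 (L : Fin 6 → ℤ × ℤ) : Fin 6 → ℤ × ℤ := fun i =>
  if h : (i : ℕ) = 0 then L 5 - (2, 2)
  else L ⟨(i : ℕ) - 1, by have := i.isLt; omega⟩

/-- One move: a right helix, a left helix, or an orthogonal swap of two adjacent
entries `L_t, L_{t+1}` with `L_t − L_{t+1} ∈ Imm₂ ∩ (−Imm₂)`. -/
def Move2 (L L' : Fin 6 → ℤ × ℤ) : Prop :=
  L' = helixR2 L ∨ L' = helixL2 L ∨
    ∃ t : Fin 6, ∃ ht : (t : ℕ) < 5,
      L t - L ⟨(t : ℕ) + 1, by omega⟩ ∈ Imm2 ∩ negImm2 ∧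
      L' = L ∘ Equiv.swap t ⟨(t : ℕ) + 1, by omega⟩

/-- Vertically lex ordered. -/
def VertLex2 (L : Fin 6 → ℤ × ℤ) : Prop :=
  ∀ i j : Fin 6, i < j →
    (L i).2 < (L j).2 ∨ ((L i).2 = (L j).2 ∧ (L i).1 < (L j).1)

/-- Horizontally lex ordered. -/
def HorLex2 (L : Fin 6 → ℤ × ℤ) : Prop :=
  ∀ i j : Fin 6, i < j →
    (L i).1 < (L j).1 ∨ ((L i).1 = (L j).1 ∧ (L i).2 < (L j).2)

/-- Difference condition. -/
def Ex (x y : ℤ) : Prop := x = 1 ∨ y = 1 ∨ x + y = 2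
def Lt2 (x y x' y' : ℤ) : Prop := y < y' ∨ (y = y' ∧ x < x')
def Ch (x0 y0 x1 y1 x2 y2 x3 y3 x4 y4 x5 y5 : ℤ) : Prop :=
  Lt2 x0 y0 x1 y1 ∧ Lt2 x1 y1 x2 y2 ∧ Lt2 x2 y2 x3 y3 ∧ Lt2 x3 y3 x4 y4 ∧ Lt2 x4 y4 x5 y5
def LexO (x0 y0 x1 y1 x2 y2 x3 y3 x4 y4 x5 y5 : ℤ) : Prop :=
  Ch x0 y0 x1 y1 x2 y2 x3 y3 x4 y4 x5 y5 ∨ Ch y0 x0 y1 x1 y2 x2 y3 x3 y4 x4 y5 x5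

theorem Ex.tri0 {x y : ℤ} (h : Ex x y) : x = 1 ∨ (x ≠ 1 ∧ y = 1) ∨ (x ≠ 1 ∧ y = 2 - x) := by
  unfold Ex at h; omega
theorem Ex.tri {x y x' y' : ℤ} (h : Ex (x' - x) (y' - y)) :
    x' = x + 1 ∨ (x' ≠ x + 1 ∧ y' = y + 1) ∨ (x' ≠ x + 1 ∧ y' = y + 2 + x - x') := by
  unfold Ex at h; omega
theorem Ex.symm {x y : ℤ} (h : Ex x y) : Ex y x := by
  unfold Ex at *; omega
theorem LexO.symm {x0 y0 x1 y1 x2 y2 x3 y3 x4 y4 x5 y5 : ℤ}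
    (h : LexO x0 y0 x1 y1 x2 y2 x3 y3 x4 y4 x5 y5) :
    LexO y0 x0 y1 x1 y2 x2 y3 x3 y4 x4 y5 x5 := Or.symm h

def G (x1 y1 x2 y2 x3 y3 x4 y4 x5 y5 : ℤ) : Prop :=
  LexO 0 0 x1 y1 x2 y2 x3 y3 x4 y4 x5 y5 ∨
  LexO x1 y1 x2 y2 x3 y3 x4 y4 x5 y5 2 2 ∨
  LexO (x5 - 2) (y5 - 2) 0 0 x1 y1 x2 y2 x3 y3 x4 y4 ∨
  (Ex (x1 - x2) (y1 - y2) ∧ LexO 0 0 x2 y2 x1 y1 x3 y3 x4 y4 x5 y5) ∨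
  (Ex (x2 - x3) (y2 - y3) ∧ LexO 0 0 x1 y1 x3 y3 x2 y2 x4 y4 x5 y5) ∨
  (Ex (x3 - x4) (y3 - y4) ∧ LexO 0 0 x1 y1 x2 y2 x4 y4 x3 y3 x5 y5)

theorem G.symm {x1 y1 x2 y2 x3 y3 x4 y4 x5 y5 : ℤ} (h : G x1 y1 x2 y2 x3 y3 x4 y4 x5 y5) :
    G y1 x1 y2 x2 y3 x3 y4 x4 y5 x5 := by
  rcases h with h | h | h | ⟨e, h⟩ | ⟨e, h⟩ | ⟨e, h⟩
  · exact Or.inl h.symm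
  · exact Or.inr (Or.inl h.symm)
  · exact Or.inr (Or.inr (Or.inl h.symm))
  · exact Or.inr (Or.inr (Or.inr (Or.inl ⟨e.symm, h.symm⟩)))
  · exact Or.inr (Or.inr (Or.inr (Or.inr (Or.inl ⟨e.symm, h.symm⟩))))
  · exact Or.inr (Or.inr (Or.inr (Or.inr (Or.inr ⟨e.symm, h.symm⟩))))

set_option maxHeartbeats 0 in
theorem coreX (x1 y1 x2 y2 x3 y3 x4 y4 x5 y5 : ℤ)
    (e01 : x1 = 1)
    (h02 : Ex x2 y2)
    (h12 : Ex (x2 - x1) (y2 - y1))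
    (h03 : Ex x3 y3)
    (h13 : Ex (x3 - x1) (y3 - y1))
    (h23 : Ex (x3 - x2) (y3 - y2))
    (h04 : Ex x4 y4)
    (h14 : Ex (x4 - x1) (y4 - y1))
    (h24 : Ex (x4 - x2) (y4 - y2))
    (h34 : Ex (x4 - x3) (y4 - y3))
    (h05 : Ex x5 y5)
    (h15 : Ex (x5 - x1) (y5 - y1))
    (h25 : Ex (x5 - x2) (y5 - y2))
    (h35 : Ex (x5 - x3) (y5 - y3))
    (h45 : Ex (x5 - x4) (y5 - y4)) :
    G x1 y1 x2 y2 x3 y3 x4 y4 x5 y5 := by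
  subst e01
  all_goals (rcases h02.tri0 with e02 | ⟨n02, e02⟩ | ⟨n02, e02⟩ <;> clear h02)
  all_goals try subst e02
  all_goals (rcases h12.tri with e12 | ⟨n12, e12⟩ | ⟨n12, e12⟩ <;> clear h12)
  all_goals try subst e12
  all_goals try (exfalso; omega)
  all_goals (rcases h03.tri0 with e03 | ⟨n03, e03⟩ | ⟨n03, e03⟩ <;> clear h03)
  all_goals try subst e03
  all_goals (rcases h13.tri with e13 | ⟨n13, e13⟩ | ⟨n13, e13⟩ <;> clear h13)
  all_goals try subst e13
  all_goals try (exfalso; omega)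
  all_goals (rcases h23.tri with e23 | ⟨n23, e23⟩ | ⟨n23, e23⟩ <;> clear h23)
  all_goals try subst e23
  all_goals try (exfalso; omega)
  all_goals (rcases h04.tri0 with e04 | ⟨n04, e04⟩ | ⟨n04, e04⟩ <;> clear h04)
  all_goals try subst e04
  all_goals (rcases h14.tri with e14 | ⟨n14, e14⟩ | ⟨n14, e14⟩ <;> clear h14)
  all_goals try subst e14
  all_goals try (exfalso; omega)
  all_goals (rcases h24.tri with e24 | ⟨n24, e24⟩ | ⟨n24, e24⟩ <;> clear h24)
  all_goals try subst e24
  all_goals try (exfalso; omega)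
  all_goals (rcases h34.tri with e34 | ⟨n34, e34⟩ | ⟨n34, e34⟩ <;> clear h34)
  all_goals try subst e34
  all_goals try (exfalso; omega)
  all_goals (rcases h05.tri0 with e05 | ⟨n05, e05⟩ | ⟨n05, e05⟩ <;> clear h05)
  all_goals try subst e05
  all_goals (rcases h15.tri with e15 | ⟨n15, e15⟩ | ⟨n15, e15⟩ <;> clear h15)
  all_goals try subst e15
  all_goals try (exfalso; omega)
  all_goals (rcases h25.tri with e25 | ⟨n25, e25⟩ | ⟨n25, e25⟩ <;> clear h25)
  all_goals try subst e25
  all_goals try (exfalso; omega)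
  all_goals (rcases h35.tri with e35 | ⟨n35, e35⟩ | ⟨n35, e35⟩ <;> clear h35)
  all_goals try subst e35
  all_goals try (exfalso; omega)
  all_goals (rcases h45.tri with e45 | ⟨n45, e45⟩ | ⟨n45, e45⟩ <;> clear h45)
  all_goals try subst e45
  all_goals try (exfalso; omega)
  all_goals unfold G LexO Ch Lt2 Ex
  all_goals first
    | exact Or.inl (Or.inl (by omega))
    | exact Or.inl (Or.inr (by omega))
    | exact Or.inr (Or.inl (Or.inl (by omega)))
    | exact Or.inr (Or.inl (Or.inr (by omega)))
    | exact Or.inr (Or.inr (Or.inl (Or.inl (by omega))))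
    | exact Or.inr (Or.inr (Or.inl (Or.inr (by omega))))
    | exact Or.inr (Or.inr (Or.inr (Or.inl ⟨by omega, Or.inl (by omega)⟩)))
    | exact Or.inr (Or.inr (Or.inr (Or.inl ⟨by omega, Or.inr (by omega)⟩)))
    | exact Or.inr (Or.inr (Or.inr (Or.inr (Or.inl ⟨by omega, Or.inl (by omega)⟩))))
    | exact Or.inr (Or.inr (Or.inr (Or.inr (Or.inl ⟨by omega, Or.inr (by omega)⟩))))
    | exact Or.inr (Or.inr (Or.inr (Or.inr (Or.inr ⟨by omega, Or.inl (by omega)⟩))))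
    | exact Or.inr (Or.inr (Or.inr (Or.inr (Or.inr ⟨by omega, Or.inr (by omega)⟩))))

set_option maxHeartbeats 0 in
theorem coreS (x1 y1 x2 y2 x3 y3 x4 y4 x5 y5 : ℤ)
    (n01 : 1 < x1) (e01 : y1 = 2 - x1)
    (h02 : Ex x2 y2)
    (h12 : Ex (x2 - x1) (y2 - y1))
    (h03 : Ex x3 y3)
    (h13 : Ex (x3 - x1) (y3 - y1))
    (h23 : Ex (x3 - x2) (y3 - y2))
    (h04 : Ex x4 y4)
    (h14 : Ex (x4 - x1) (y4 - y1))
    (h24 : Ex (x4 - x2) (y4 - y2))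
    (h34 : Ex (x4 - x3) (y4 - y3))
    (h05 : Ex x5 y5)
    (h15 : Ex (x5 - x1) (y5 - y1))
    (h25 : Ex (x5 - x2) (y5 - y2))
    (h35 : Ex (x5 - x3) (y5 - y3))
    (h45 : Ex (x5 - x4) (y5 - y4)) :
    G x1 y1 x2 y2 x3 y3 x4 y4 x5 y5 := by
  subst e01
  all_goals (rcases h02.tri0 with e02 | ⟨n02, e02⟩ | ⟨n02, e02⟩ <;> clear h02)
  all_goals try subst e02
  all_goals (rcases h12.tri with e12 | ⟨n12, e12⟩ | ⟨n12, e12⟩ <;> clear h12)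
  all_goals try subst e12
  all_goals try (exfalso; omega)
  all_goals (rcases h03.tri0 with e03 | ⟨n03, e03⟩ | ⟨n03, e03⟩ <;> clear h03)
  all_goals try subst e03
  all_goals (rcases h13.tri with e13 | ⟨n13, e13⟩ | ⟨n13, e13⟩ <;> clear h13)
  all_goals try subst e13
  all_goals try (exfalso; omega)
  all_goals (rcases h23.tri with e23 | ⟨n23, e23⟩ | ⟨n23, e23⟩ <;> clear h23)
  all_goals try subst e23
  all_goals try (exfalso; omega)
  all_goals (rcases h04.tri0 with e04 | ⟨n04, e04⟩ | ⟨n04, e04⟩ <;> clear h04)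
  all_goals try subst e04
  all_goals (rcases h14.tri with e14 | ⟨n14, e14⟩ | ⟨n14, e14⟩ <;> clear h14)
  all_goals try subst e14
  all_goals try (exfalso; omega)
  all_goals (rcases h24.tri with e24 | ⟨n24, e24⟩ | ⟨n24, e24⟩ <;> clear h24)
  all_goals try subst e24
  all_goals try (exfalso; omega)
  all_goals (rcases h34.tri with e34 | ⟨n34, e34⟩ | ⟨n34, e34⟩ <;> clear h34)
  all_goals try subst e34
  all_goals try (exfalso; omega)
  all_goals (rcases h05.tri0 with e05 | ⟨n05, e05⟩ | ⟨n05, e05⟩ <;> clear h05)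
  all_goals try subst e05
  all_goals (rcases h15.tri with e15 | ⟨n15, e15⟩ | ⟨n15, e15⟩ <;> clear h15)
  all_goals try subst e15
  all_goals try (exfalso; omega)
  all_goals (rcases h25.tri with e25 | ⟨n25, e25⟩ | ⟨n25, e25⟩ <;> clear h25)
  all_goals try subst e25
  all_goals try (exfalso; omega)
  all_goals (rcases h35.tri with e35 | ⟨n35, e35⟩ | ⟨n35, e35⟩ <;> clear h35)
  all_goals try subst e35
  all_goals try (exfalso; omega)
  all_goals (rcases h45.tri with e45 | ⟨n45, e45⟩ | ⟨n45, e45⟩ <;> clear h45)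
  all_goals try subst e45
  all_goals try (exfalso; omega)
  all_goals unfold G LexO Ch Lt2 Ex
  all_goals first
    | exact Or.inl (Or.inl (by omega))
    | exact Or.inl (Or.inr (by omega))
    | exact Or.inr (Or.inl (Or.inl (by omega)))
    | exact Or.inr (Or.inl (Or.inr (by omega)))
    | exact Or.inr (Or.inr (Or.inl (Or.inl (by omega))))
    | exact Or.inr (Or.inr (Or.inl (Or.inr (by omega))))
    | exact Or.inr (Or.inr (Or.inr (Or.inl ⟨by omega, Or.inl (by omega)⟩)))
    | exact Or.inr (Or.inr (Or.inr (Or.inl ⟨by omega, Or.inr (by omega)⟩)))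
    | exact Or.inr (Or.inr (Or.inr (Or.inr (Or.inl ⟨by omega, Or.inl (by omega)⟩))))
    | exact Or.inr (Or.inr (Or.inr (Or.inr (Or.inl ⟨by omega, Or.inr (by omega)⟩))))
    | exact Or.inr (Or.inr (Or.inr (Or.inr (Or.inr ⟨by omega, Or.inl (by omega)⟩))))
    | exact Or.inr (Or.inr (Or.inr (Or.inr (Or.inr ⟨by omega, Or.inr (by omega)⟩))))

theorem core (x1 y1 x2 y2 x3 y3 x4 y4 x5 y5 : ℤ)
    (h01 : Ex x1 y1)
    (h02 : Ex x2 y2)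
    (h12 : Ex (x2 - x1) (y2 - y1))
    (h03 : Ex x3 y3)
    (h13 : Ex (x3 - x1) (y3 - y1))
    (h23 : Ex (x3 - x2) (y3 - y2))
    (h04 : Ex x4 y4)
    (h14 : Ex (x4 - x1) (y4 - y1))
    (h24 : Ex (x4 - x2) (y4 - y2))
    (h34 : Ex (x4 - x3) (y4 - y3))
    (h05 : Ex x5 y5)
    (h15 : Ex (x5 - x1) (y5 - y1))
    (h25 : Ex (x5 - x2) (y5 - y2))
    (h35 : Ex (x5 - x3) (y5 - y3))
    (h45 : Ex (x5 - x4) (y5 - y4)) :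
    G x1 y1 x2 y2 x3 y3 x4 y4 x5 y5 := by
  have h : x1 = 1 ∨ y1 = 1 ∨ (1 < x1 ∧ y1 = 2 - x1) ∨ (1 < y1 ∧ x1 = 2 - y1) := by
    unfold Ex at h01; omega
  rcases h with h | h | ⟨h, h'⟩ | ⟨h, h'⟩
  · exact coreX x1 y1 x2 y2 x3 y3 x4 y4 x5 y5 h h02 h12 h03 h13 h23 h04 h14 h24 h34 h05 h15 h25 h35 h45
  · exact (coreX y1 x1 y2 x2 y3 x3 y4 x4 y5 x5 h h02.symm h12.symm h03.symm h13.symm h23.symm h04.symm h14.symm h24.symm h34.symm h05.symm h15.symm h25.symm h35.symm h45.symm).symm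
  · exact coreS x1 y1 x2 y2 x3 y3 x4 y4 x5 y5 h h' h02 h12 h03 h13 h23 h04 h14 h24 h34 h05 h15 h25 h35 h45
  · exact (coreS y1 x1 y2 x2 y3 x3 y4 x4 y5 x5 h h' h02.symm h12.symm h03.symm h13.symm h23.symm h04.symm h14.symm h24.symm h34.symm h05.symm h15.symm h25.symm h35.symm h45.symm).symm

theorem ex_of_imm {p q : ℤ × ℤ} (h : p - q ∈ Imm2) : Ex (q.1 - p.1) (q.2 - p.2) := by
  simp only [Imm2, Set.mem_union, Set.mem_ofPred_eq, Prod.fst_sub, Prod.snd_sub] at h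
  unfold Ex; omega

theorem imm_of_ex {p q : ℤ × ℤ} (h : Ex (q.1 - p.1) (q.2 - p.2)) : p - q ∈ Imm2 := by
  simp only [Imm2, Set.mem_union, Set.mem_ofPred_eq, Prod.fst_sub, Prod.snd_sub]
  unfold Ex at h; omega

theorem ch_lt {f g : Fin 6 → ℤ} (h : Ch (f 0) (g 0) (f 1) (g 1) (f 2) (g 2) (f 3) (g 3)
    (f 4) (g 4) (f 5) (g 5)) (i j : Fin 6) (hij : i < j) : Lt2 (f i) (g i) (f j) (g j) := by
  obtain ⟨h0, h1, h2, h3, h4⟩ := h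
  unfold Lt2 at *
  fin_cases i <;> fin_cases j <;> first | (exfalso; revert hij; decide) | (simp; omega)

theorem lex_of {M : Fin 6 → ℤ × ℤ} {a b : ℤ}
    (h : LexO ((M 0).1 - a) ((M 0).2 - b) ((M 1).1 - a) ((M 1).2 - b) ((M 2).1 - a) ((M 2).2 - b) ((M 3).1 - a) ((M 3).2 - b) ((M 4).1 - a) ((M 4).2 - b) ((M 5).1 - a) ((M 5).2 - b)) : VertLex2 M ∨ HorLex2 M := by
  rcases h with h | h
  · left
    intro i j hij
    have := ch_lt (f := fun i => (M i).1 - a) (g := fun i => (M i).2 - b) h i j hij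
    unfold Lt2 at this; omega
  · right
    intro i j hij
    have := ch_lt (f := fun i => (M i).2 - b) (g := fun i => (M i).1 - a) h i j hij
    unfold Lt2 at this; omega

theorem exc_R {L : Fin 6 → ℤ × ℤ} (hL : IsExcSeq2 L) : IsExcSeq2 (helixR2 L) := by
  intro i j hij
  have hi := j.isLt
  have hij' : (i : ℕ) < j := hij
  have h5 : (i : ℕ) < 5 := by omega
  unfold helixR2
  rw [dif_pos h5]
  split_ifs with hj
  · apply hL
    rw [Fin.lt_def]
    change (i : ℕ) + 1 < (j : ℕ) + 1
    omega
  · have := hL 0 ⟨(i : ℕ) + 1, by omega⟩ (by simp [Fin.lt_def])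
    simp only [Imm2, Set.mem_union, Set.mem_ofPred_eq, Prod.fst_sub, Prod.snd_sub, Prod.fst_add, Prod.snd_add] at *
    omega

theorem exc_L {L : Fin 6 → ℤ × ℤ} (hL : IsExcSeq2 L) : IsExcSeq2 (helixL2 L) := by
  intro i j hij
  have hi := j.isLt
  have hij' : (i : ℕ) < j := hij
  have h5 : ¬ (j : ℕ) = 0 := by omega
  unfold helixL2
  rw [dif_neg h5]
  split_ifs with hj
  · have := hL ⟨(j : ℕ) - 1, by omega⟩ 5 (by rw [Fin.lt_def]; change (j : ℕ) - 1 < 5; omega)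
    simp only [Imm2, Set.mem_union, Set.mem_ofPred_eq, Prod.fst_sub, Prod.snd_sub] at *
    omega
  · apply hL
    rw [Fin.lt_def]
    change (i : ℕ) - 1 < (j : ℕ) - 1
    omega

theorem exc_S {L : Fin 6 → ℤ × ℤ} (hL : IsExcSeq2 L) (t u : Fin 6) (hu : (u : ℕ) = t + 1)
    (h : L u - L t ∈ Imm2) : IsExcSeq2 (L ∘ Equiv.swap t u) := by
  intro i j hij
  simp only [Function.comp]
  by_cases hc : i = t ∧ j = u
  · obtain ⟨rfl, rfl⟩ := hc
    simpa using h
  · apply hL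
    rw [Equiv.swap_apply_def, Equiv.swap_apply_def]
    split_ifs <;> simp only [Fin.lt_def, Fin.ext_iff] at * <;> omega

theorem swap_case {L : Fin 6 → ℤ × ℤ} (hL : IsExcSeq2 L) (t : Fin 6) (ht : (t : ℕ) < 5)
    (u : Fin 6) (hu : u = ⟨(t : ℕ) + 1, by omega⟩) (h : L u - L t ∈ Imm2)
    (hl : VertLex2 (L ∘ Equiv.swap t u) ∨ HorLex2 (L ∘ Equiv.swap t u)) :
    ∃ L' : Fin 6 → ℤ × ℤ, Relation.ReflTransGen Move2 L L' ∧ IsExcSeq2 L' ∧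
      (VertLex2 L' ∨ HorLex2 L') := by
  refine ⟨L ∘ Equiv.swap t u, .single (Or.inr (Or.inr ⟨t, ht, ⟨?_, ?_⟩, ?_⟩)), exc_S hL t u ?_ h, hl⟩
  · exact hL _ _ (by simp [Fin.lt_def])
  · change -(L t - L _) ∈ Imm2
    rw [neg_sub, ← hu]; exact h
  · rw [hu]
  · rw [hu]

/-- every maximal exceptional sequence on `X₂` can be transformed by
finitely many right/left helixings and orthogonal swaps into an exceptional sequence
which is vertically or horizontally lex ordered. -/
theorem stmt2 (L : Fin 6 → ℤ × ℤ) (hL : IsExcSeq2 L) :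
    ∃ L' : Fin 6 → ℤ × ℤ, Relation.ReflTransGen Move2 L L' ∧ IsExcSeq2 L' ∧
      (VertLex2 L' ∨ HorLex2 L') := by
  have hs : ∀ i j : Fin 6, i < j →
      Ex ((L j).1 - (L 0).1 - ((L i).1 - (L 0).1)) ((L j).2 - (L 0).2 - ((L i).2 - (L 0).2)) := by
    intro i j hij
    rw [sub_sub_sub_cancel_right, sub_sub_sub_cancel_right]
    exact ex_of_imm (hL i j hij)
  have hz : ∀ j : Fin 6, 0 < j → Ex ((L j).1 - (L 0).1) ((L j).2 - (L 0).2) :=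
    fun j hj => ex_of_imm (hL 0 j hj)
  have hr : ∀ i j : Fin 6,
      Ex ((L j).1 - (L 0).1 - ((L i).1 - (L 0).1)) ((L j).2 - (L 0).2 - ((L i).2 - (L 0).2)) →
      L i - L j ∈ Imm2 := by
    intro i j h
    rw [sub_sub_sub_cancel_right, sub_sub_sub_cancel_right] at h
    exact imm_of_ex h
  have key := core _ _ _ _ _ _ _ _ _ _
    (hz 1 (by decide)) (hz 2 (by decide)) (hs 1 2 (by decide)) (hz 3 (by decide)) (hs 1 3 (by decide)) (hs 2 3 (by decide)) (hz 4 (by decide)) (hs 1 4 (by decide)) (hs 2 4 (by decide)) (hs 3 4 (by decide)) (hz 5 (by decide)) (hs 1 5 (by decide)) (hs 2 5 (by decide)) (hs 3 5 (by decide)) (hs 4 5 (by decide))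
  rcases key with h | h | h | ⟨e, h⟩ | ⟨e, h⟩ | ⟨e, h⟩
  · refine ⟨L, .refl, hL, lex_of (a := (L 0).1) (b := (L 0).2) ?_⟩
    simpa using h
  · refine ⟨helixR2 L, .single (Or.inl rfl), exc_R hL, lex_of (a := (L 0).1) (b := (L 0).2) ?_⟩
    convert h using 1 <;> simp [helixR2]
  · refine ⟨helixL2 L, .single (Or.inr (Or.inl rfl)), exc_L hL,
      lex_of (a := (L 0).1) (b := (L 0).2) ?_⟩
    convert h using 1 <;> simp [helixL2] <;> first | rfl | omega
  · refine swap_case hL 1 (by decide) 2 rfl (hr 2 1 e) (lex_of (a := (L 0).1) (b := (L 0).2) ?_)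
    convert h using 1 <;> simp [Equiv.swap_apply_def]
  · refine swap_case hL 2 (by decide) 3 rfl (hr 3 2 e) (lex_of (a := (L 0).1) (b := (L 0).2) ?_)
    convert h using 1 <;> simp [Equiv.swap_apply_def]
  · refine swap_case hL 3 (by decide) 4 rfl (hr 4 3 e) (lex_of (a := (L 0).1) (b := (L 0).2) ?_)
    convert h using 1 <;> simp [Equiv.swap_apply_def]
end

section
/- With the notation of the context, CH0 ∩ (−Imm) ⊆ Acyc if and only if ℓ ≥ αv. -/
/-- `Eff ∩ (−Imm) ⊆ Acyc` if and only if `ℓ ≥ αv`. -/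
theorem eff_inter_negImm_subset_acyc_iff
    (ℓ v : ℕ) (hℓ : 1 ≤ ℓ) (hv : 1 ≤ v) (c : Fin v → ℤ)
    (hc0 : c ⟨0, by omega⟩ ≤ 0) (hc : Antitone c)
    (α β : ℤ) (hα : α = -c ⟨v - 1, by omega⟩) (hβ : β = -(∑ i, c i)) :
    CH0 α ∩ negImm ℓ v α β ⊆ Acyc ℓ v α β ↔ α * (v : ℤ) ≤ (ℓ : ℤ) := by
  have hβle : β ≤ α * (v : ℤ) := by
    have h : ∑ i, (-c i) ≤ ∑ _i : Fin v, α := by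
      apply Finset.sum_le_sum
      intro i _
      rw [hα]
      apply neg_le_neg
      apply hc
      rw [Fin.le_def]
      have := i.2
      simp only
      omega
    simp only [Finset.sum_neg_distrib, Finset.sum_const, Finset.card_univ, Fintype.card_fin,
      nsmul_eq_mul] at h
    rw [hβ]
    linarith [mul_comm α (v : ℤ)]
  clear hα hβ
  constructor
  · intro h
    by_contra hlt
    push Not at hlt
    have hm : ((-(ℓ : ℤ) - 1, (v : ℤ)) : ℤ × ℤ) ∈ CH0 α ∩ negImm ℓ v α β := by
      refine ⟨⟨?_, ?_⟩, ?_⟩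
      · simp
      · simp only
        omega
      · rintro (((h | h) | h) | h) <;>
        · have := h.1
          simp only [Prod.snd_neg] at this
          omega
    exact h hm (Or.inl (Or.inl ⟨by simp, le_refl _⟩))
  · rintro hle ⟨i, j⟩ ⟨⟨hj, hi⟩, hn⟩ hbad
    simp only at hj hi
    rcases hbad with (⟨_, h⟩ | ⟨h, _⟩) | ⟨h, _⟩
    · simp only at h
      by_cases hjv : j ≤ v
      · have hα0 : 0 < α := by
          by_contra h0
          nlinarith
        nlinarith
      · apply hn
        left
        right
        refine ⟨?_, ?_⟩
        · simp only [Prod.snd_neg]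
          omega
        · simp only [Prod.fst_neg]
          omega
    · simp only at h
      omega
    · simp only at h
      omega
end

section
/- Let ℓ ≥ 2 and let s ⊆ ℤ² be an exceptional set with respect to Imm_ℓ having exactly ℓ(ℓ+1) elements (a maximal exceptional set). Then for every p ∈ (ℤ/(ℓ+1)ℤ)² the shifted diagonal p + Δ meets Φ(s) in exactly ℓ points; consequently there is a unique gap point q ∈ p + Δ with q ∉ Φ(s), and Φ(s) ∩ (p + Δ) = {q + Φ(1,1), q + Φ(2,2), …, q + Φ(ℓ,ℓ)}. Moreover, for every exceptional enumeration (L₁,…,L_{ℓ(ℓ+1)}) of s: if Φ(L_a) = q + Φ(k,k) and Φ(L_b) = q + Φ(k+1,k+1) for some 1 ≤ k ≤ ℓ−1, then a < b. -/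
/-- The immaculate locus of `X_ℓ = P(Ω_{P^ℓ}(−1))` in `Pic(X_ℓ) ≅ ℤ²`. -/
def ImmL (ℓ : ℕ) : Set (ℤ × ℤ) :=
  {p | -(ℓ : ℤ) + 1 ≤ p.2 ∧ p.2 ≤ -1} ∪
    {p | -(ℓ : ℤ) + 1 ≤ p.1 ∧ p.1 ≤ -1} ∪
    {p | p.1 + p.2 = -(ℓ : ℤ)}

/-- Coordinatewise reduction `Φ : ℤ² → (ℤ/(ℓ+1)ℤ)²`. -/
def PhiL (ℓ : ℕ) (p : ℤ × ℤ) : ZMod (ℓ + 1) × ZMod (ℓ + 1) :=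
  ((p.1 : ZMod (ℓ + 1)), (p.2 : ZMod (ℓ + 1)))

/-- The diagonal `Δ ⊆ (ℤ/(ℓ+1)ℤ)²`. -/
def DeltaL (ℓ : ℕ) : Set (ZMod (ℓ + 1) × ZMod (ℓ + 1)) :=
  {q | ∃ k : ℤ, q = ((k : ZMod (ℓ + 1)), (k : ZMod (ℓ + 1)))}

/-- `(L₁,…,L_n)` is an exceptional sequence: `L_a − L_b ∈ Imm_ℓ` for `a < b`. -/
def IsExcSeqL (ℓ n : ℕ) (L : Fin n → ℤ × ℤ) : Prop :=
  ∀ i j : Fin n, i < j → L i - L j ∈ ImmL ℓ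

/-- A finite set `s ⊆ ℤ²` is exceptional if some enumeration of it is an
exceptional sequence. -/
def IsExcSetL (ℓ : ℕ) (s : Finset (ℤ × ℤ)) : Prop :=
  ∃ L : Fin s.card → ℤ × ℤ, Function.Injective L ∧ (∀ i, L i ∈ s) ∧
    IsExcSeqL ℓ s.card L

theorem aux_dvd {ℓ : ℕ} (a b : ℤ) (h : (a : ZMod (ℓ + 1)) = (b : ZMod (ℓ + 1))) :
    ∃ m : ℤ, a = b + ((ℓ : ℤ) + 1) * m := by
  rw [ZMod.intCast_eq_intCast_iff_dvd_sub] at h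
  obtain ⟨m, hm⟩ := h
  refine ⟨-m, ?_⟩
  push_cast at hm
  linarith

theorem aux_small {ℓ : ℤ} (m r : ℤ) (hℓ : 2 ≤ ℓ) (h1 : 0 < r) (h2 : r < ℓ + 1)
    (h : (ℓ + 1) * m = r) : False := by
  have h3 : 0 < m := by
    by_contra hc
    nlinarith
  nlinarith

theorem aux_inj {ℓ : ℕ} (hℓ : 2 ≤ ℓ) (u v : ℤ × ℤ) (h : PhiL ℓ u = PhiL ℓ v)
    (hi : u - v ∈ ImmL ℓ) : False := by
  have hℓ' : (2 : ℤ) ≤ ℓ := by exact_mod_cast hℓ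
  simp only [PhiL, Prod.mk.injEq] at h
  obtain ⟨m, hm⟩ := aux_dvd _ _ h.1
  obtain ⟨k, hk⟩ := aux_dvd _ _ h.2
  simp only [ImmL, Set.mem_union, Set.mem_setOf_eq, Prod.fst_sub, Prod.snd_sub] at hi
  rcases hi with (hi | hi) | hi
  · exact aux_small (-k) (v.2 - u.2) hℓ' (by linarith) (by linarith) (by linarith)
  · exact aux_small (-m) (v.1 - u.1) hℓ' (by linarith) (by linarith) (by linarith)
  · exact aux_small (-m - k) ℓ hℓ' (by linarith) (by linarith) (by linarith)

theorem aux_succ {ℓ : ℕ} (hℓ : 2 ≤ ℓ) (u v : ℤ × ℤ)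
    (h : PhiL ℓ u = PhiL ℓ v + (1, 1))
    (hi : u - v ∈ ImmL ℓ) : False := by
  have hℓ' : (2 : ℤ) ≤ ℓ := by exact_mod_cast hℓ
  simp only [PhiL, Prod.mk_add_mk, Prod.mk.injEq] at h
  obtain ⟨m, hm⟩ := aux_dvd u.1 (v.1 + 1) (by push_cast; exact h.1)
  obtain ⟨k, hk⟩ := aux_dvd u.2 (v.2 + 1) (by push_cast; exact h.2)
  simp only [ImmL, Set.mem_union, Set.mem_setOf_eq, Prod.fst_sub, Prod.snd_sub] at hi
  rcases hi with (hi | hi) | hi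
  · exact aux_small (-k) (v.2 + 1 - u.2) hℓ' (by linarith) (by linarith) (by linarith)
  · exact aux_small (-m) (v.1 + 1 - u.1) hℓ' (by linarith) (by linarith) (by linarith)
  · exact aux_small (-m - k - 1) 1 hℓ' (by linarith) (by linarith) (by linarith)

theorem aux_lt {ℓ n : ℕ} (hℓ : 2 ≤ ℓ) (L : Fin n → ℤ × ℤ) (hL : IsExcSeqL ℓ n L)
    (a b : Fin n) (h : PhiL ℓ (L b) = PhiL ℓ (L a) + (1, 1)) : a < b := by
  rcases lt_trichotomy a b with h1 | h1 | h1
  · exact h1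
  · subst h1
    have : Fact (1 < ℓ + 1) := ⟨by omega⟩
    have := congrArg Prod.fst h
    simp at this
  · exact (aux_succ hℓ _ _ h (hL _ _ h1)).elim

theorem aux_diag {ℓ : ℕ} (p q : ZMod (ℓ + 1) × ZMod (ℓ + 1)) :
    q ∈ (fun d => p + d) '' DeltaL ℓ ↔ q.2 - q.1 = p.2 - p.1 := by
  constructor
  · rintro ⟨_, ⟨k, rfl⟩, rfl⟩
    simp
  · intro h
    obtain ⟨k, hk⟩ := ZMod.intCast_surjective (q.1 - p.1)
    refine ⟨_, ⟨k, rfl⟩, ?_⟩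
    ext
    · simp [hk]
    · simp only [Prod.snd_add, hk]
      linear_combination -h

theorem aux_gap {ℓ : ℕ} (hℓ : 2 ≤ ℓ) (s : Finset (ℤ × ℤ))
    (hcard : s.card = ℓ * (ℓ + 1)) (hs : IsExcSetL ℓ s) (c : ZMod (ℓ + 1)) :
    ∃ q : ZMod (ℓ + 1) × ZMod (ℓ + 1), q.2 - q.1 = c ∧ q ∉ PhiL ℓ '' (s : Set (ℤ × ℤ)) ∧
      ∀ q' : ZMod (ℓ + 1) × ZMod (ℓ + 1), q'.2 - q'.1 = c →
        q' ∉ PhiL ℓ '' (s : Set (ℤ × ℤ)) → q' = q := by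
  classical
  obtain ⟨L, hinj, hmem, hexc⟩ := hs
  have himg : Finset.univ.image L = s := by
    apply Finset.eq_of_subset_of_card_le
    · intro x hx
      obtain ⟨i, -, rfl⟩ := Finset.mem_image.1 hx
      exact hmem i
    · rw [Finset.card_image_of_injective _ hinj]; simp
  have hsurj : ∀ x ∈ s, ∃ i, L i = x := by
    intro x hx
    rw [← himg] at hx
    simpa using hx
  set T : Finset (ZMod (ℓ + 1) × ZMod (ℓ + 1)) := s.image (PhiL ℓ) with hT
  have hTs : PhiL ℓ '' (s : Set (ℤ × ℤ)) = (T : Set _) := by simp [hT]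
  have hTcard : T.card = ℓ * (ℓ + 1) := by
    rw [hT, Finset.card_image_of_injOn, hcard]
    intro x hx y hy hxy
    obtain ⟨i, rfl⟩ := hsurj x hx
    obtain ⟨j, rfl⟩ := hsurj y hy
    rcases lt_trichotomy i j with h | h | h
    · exact (aux_inj hℓ _ _ hxy (hexc _ _ h)).elim
    · rw [h]
    · exact (aux_inj hℓ _ _ hxy.symm (hexc _ _ h)).elim
  have hTc : Tᶜ.card = ℓ + 1 := by
    rw [Finset.card_compl, hTcard, Fintype.card_prod, ZMod.card, ← Nat.sub_mul]
    simp
  have hex : ∀ c : ZMod (ℓ + 1), ∃ q ∈ Tᶜ, q.2 - q.1 = c := by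
    intro c
    by_contra! hc
    have hfull : ∀ x : ZMod (ℓ + 1), ∃ i, PhiL ℓ (L i) = (x, x + c) := by
      intro x
      have : (x, x + c) ∈ T := by
        by_contra hn
        exact hc (x, x + c) (Finset.mem_compl.2 hn) (by simp)
      obtain ⟨y, hy, hyx⟩ := Finset.mem_image.1 this
      obtain ⟨i, rfl⟩ := hsurj y hy
      exact ⟨i, hyx⟩
    choose i hi using hfull
    obtain ⟨x, hx⟩ := Finite.exists_max i
    have := aux_lt hℓ L hexc (i x) (i (x + 1)) (by
      rw [hi, hi]; ext
      · simp
      · simp only [Prod.snd_add]; ring)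
    exact absurd (hx (x + 1)) (not_le.2 this)
  obtain ⟨q, hq, hqc⟩ := hex c
  refine ⟨q, hqc, ?_, ?_⟩
  · rw [hTs]; simpa using hq
  · intro q' hq'c hq'
    rw [hTs] at hq'
    have hq'' : q' ∈ Tᶜ := by simpa using hq'
    refine Finset.inj_on_of_surj_on_of_card_le (s := Tᶜ)
      (t := (Finset.univ : Finset (ZMod (ℓ + 1)))) (fun q _ => q.2 - q.1) (by simp) ?_ ?_
      hq'' hq (by rw [hq'c, hqc])
    · intro b _
      obtain ⟨a, ha, hb⟩ := hex b
      exact ⟨a, ha, hb⟩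
    · rw [hTc, Finset.card_univ, ZMod.card]

/-- for a maximal exceptional set `s` (with `ℓ(ℓ+1)` elements), every
shifted diagonal `p + Δ` meets `Φ(s)` in exactly `ℓ` points; there is a unique gap
point `q`, the intersection is `{q+Φ(1,1),…,q+Φ(ℓ,ℓ)}`, and in every exceptional
enumeration the point over `q+Φ(k,k)` precedes the one over `q+Φ(k+1,k+1)`. -/
theorem stmt4 (ℓ : ℕ) (hℓ : 2 ≤ ℓ) (s : Finset (ℤ × ℤ))
    (hcard : s.card = ℓ * (ℓ + 1)) (hs : IsExcSetL ℓ s)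
    (p : ZMod (ℓ + 1) × ZMod (ℓ + 1)) :
    ((PhiL ℓ '' (s : Set (ℤ × ℤ))) ∩ ((fun d => p + d) '' DeltaL ℓ)).ncard = ℓ ∧
    ∃ q : ZMod (ℓ + 1) × ZMod (ℓ + 1),
      q ∈ (fun d => p + d) '' DeltaL ℓ ∧
      q ∉ PhiL ℓ '' (s : Set (ℤ × ℤ)) ∧
      (∀ q' ∈ (fun d => p + d) '' DeltaL ℓ,
        q' ∉ PhiL ℓ '' (s : Set (ℤ × ℤ)) → q' = q) ∧
      (PhiL ℓ '' (s : Set (ℤ × ℤ))) ∩ ((fun d => p + d) '' DeltaL ℓ) =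
        {x | ∃ k : ℕ, 1 ≤ k ∧ k ≤ ℓ ∧ x = q + PhiL ℓ ((k : ℤ), (k : ℤ))} ∧
      ∀ L : Fin s.card → ℤ × ℤ, Function.Injective L → (∀ i, L i ∈ s) →
        IsExcSeqL ℓ s.card L →
        ∀ a b : Fin s.card, ∀ k : ℕ, 1 ≤ k → k ≤ ℓ - 1 →
          PhiL ℓ (L a) = q + PhiL ℓ ((k : ℤ), (k : ℤ)) →
          PhiL ℓ (L b) = q + PhiL ℓ ((k : ℤ) + 1, (k : ℤ) + 1) →
          a < b := by
  obtain ⟨q, hqc, hq, huniq⟩ := aux_gap hℓ s hcard hs (p.2 - p.1)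
  have hset : (PhiL ℓ '' (s : Set (ℤ × ℤ))) ∩ ((fun d => p + d) '' DeltaL ℓ) =
      (fun k : ZMod (ℓ + 1) => q + (k, k)) '' {0}ᶜ := by
    ext x
    rw [Set.mem_inter_iff, aux_diag]
    constructor
    · rintro ⟨hx, hxc⟩
      refine ⟨x.1 - q.1, ?_, ?_⟩
      · intro h0
        have h0 : x.1 - q.1 = 0 := h0
        apply hq
        have : q = x := by
          ext
          · linear_combination -h0
          · linear_combination hqc - hxc - h0
        rw [this]; exact hx
      · ext
        · simp
        · simp only [Prod.snd_add]
          linear_combination hqc - hxc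
    · rintro ⟨k, hk, rfl⟩
      have hd : (q + (k, k)).2 - (q + (k, k)).1 = p.2 - p.1 := by
        simp only [Prod.snd_add, Prod.fst_add]
        linear_combination hqc
      refine ⟨?_, hd⟩
      by_contra hn
      have := congrArg Prod.fst (huniq _ hd hn)
      simp at this
      exact hk this
  refine ⟨?_, q, (aux_diag p q).2 hqc, hq, fun q' h => huniq q' ((aux_diag p q').1 h), ?_, ?_⟩
  · rw [hset, Set.ncard_image_of_injective]
    · rw [Set.ncard_compl]; simp
    · intro a b hab
      have := congrArg Prod.fst hab
      simpa using this
  · rw [hset]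
    ext x
    constructor
    · rintro ⟨k, hk, rfl⟩
      refine ⟨k.val, ?_, ?_, ?_⟩
      · rw [Nat.one_le_iff_ne_zero]
        exact fun h => hk ((ZMod.val_eq_zero k).1 h)
      · have := ZMod.val_lt k
        omega
      · simp [PhiL]
    · rintro ⟨k, hk1, hk2, rfl⟩
      refine ⟨(k : ZMod (ℓ + 1)), ?_, by simp [PhiL]⟩
      intro h0
      have h0 : (k : ZMod (ℓ + 1)) = 0 := h0
      rw [ZMod.natCast_eq_zero_iff] at h0
      have := Nat.le_of_dvd (by omega) h0
      omega
  · intro L _ _ hL a b k _ _ ha hb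
    apply aux_lt hℓ L hL
    rw [ha, hb, add_assoc]
    simp [PhiL]
end

section
/- Let ℓ ≥ 2 and let s ⊆ ℤ² be an exceptional set with respect to Imm_ℓ. Then for every p ∈ (ℤ/(ℓ+1)ℤ)² the shifted diagonal p + Δ is not entirely contained in Φ(s); equivalently, p + Δ contains at most ℓ points of Φ(s). -/
theorem aux5 (ℓ : ℕ) (hℓ : 2 ≤ ℓ) (s : Finset (ℤ × ℤ)) (hs : IsExcSetL ℓ s)
    (p : ZMod (ℓ + 1) × ZMod (ℓ + 1)) :
    ¬ ((fun d => p + d) '' DeltaL ℓ ⊆ PhiL ℓ '' (s : Set (ℤ × ℤ))) := by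
  intro hsub
  obtain ⟨L, hinj, hmem, hexc⟩ := hs
  have hsurj : ∀ x ∈ s, ∃ i, L i = x := by
    have himg : Finset.univ.image L = s := by
      apply Finset.eq_of_subset_of_card_le
      · intro x hx
        simp only [Finset.mem_image, Finset.mem_univ, true_and] at hx
        obtain ⟨i, rfl⟩ := hx
        exact hmem i
      · rw [Finset.card_image_of_injective _ hinj]; simp
    intro x hx
    rw [← himg] at hx
    simpa using hx
  have hex : ∀ k : ZMod (ℓ + 1), ∃ i, PhiL ℓ (L i) = p + (k, k) := by
    intro k
    obtain ⟨z, rfl⟩ := ZMod.intCast_surjective k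
    obtain ⟨x, hx, hxe⟩ := hsub ⟨((z : ZMod (ℓ + 1)), (z : ZMod (ℓ + 1))), ⟨z, rfl⟩, rfl⟩
    obtain ⟨i, rfl⟩ := hsurj x hx
    exact ⟨i, hxe⟩
  choose f hf using hex
  obtain ⟨k, hk⟩ := Finite.exists_max f
  have h1 := hf k
  have h2 := hf (k + 1)
  simp only [PhiL, Prod.ext_iff, Prod.fst_add, Prod.snd_add] at h1 h2
  have hx : (((L (f (k+1))).1 - (L (f k)).1 - 1 : ℤ) : ZMod (ℓ + 1)) = 0 := by
    push_cast; rw [h1.1, h2.1]; ring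
  have hy : (((L (f (k+1))).2 - (L (f k)).2 - 1 : ℤ) : ZMod (ℓ + 1)) = 0 := by
    push_cast; rw [h1.2, h2.2]; ring
  rw [ZMod.intCast_zmod_eq_zero_iff_dvd] at hx hy
  obtain ⟨u, hu⟩ := hx
  obtain ⟨v, hv⟩ := hy
  push_cast at hu hv
  have key : ∀ c w : ℤ, c = ((ℓ : ℤ) + 1) * w → c < (ℓ : ℤ) + 1 → -((ℓ : ℤ) + 1) < c → c = 0 := by
    intro c w h a b
    exact Int.eq_zero_of_abs_lt_dvd ⟨w, h⟩ (abs_lt.2 ⟨b, a⟩)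
  rcases (hk (k + 1)).lt_or_eq with hlt | heq
  · have := hexc _ _ hlt
    simp only [ImmL, Set.mem_union, Set.mem_ofPred_eq, Prod.fst_sub, Prod.snd_sub] at this
    rcases this with (h | h) | h
    · have := key _ _ hv (by omega) (by omega)
      omega
    · have := key _ _ hu (by omega) (by omega)
      omega
    · have := key 1 (-(u + v) - 1) (by linear_combination h - hu - hv) (by omega) (by omega)
      omega
  · rw [heq] at hu
    have := key _ _ hu (by omega) (by omega)
    omega

/-- for an exceptional set `s` no shifted diagonal `p + Δ` is entirely
contained in `Φ(s)`; equivalently, `p + Δ` contains at most `ℓ` points of `Φ(s)`. -/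
theorem stmt5 (ℓ : ℕ) (hℓ : 2 ≤ ℓ) (s : Finset (ℤ × ℤ)) (hs : IsExcSetL ℓ s)
    (p : ZMod (ℓ + 1) × ZMod (ℓ + 1)) :
    ¬ ((fun d => p + d) '' DeltaL ℓ ⊆ PhiL ℓ '' (s : Set (ℤ × ℤ))) ∧
    ((PhiL ℓ '' (s : Set (ℤ × ℤ))) ∩ ((fun d => p + d) '' DeltaL ℓ)).ncard ≤ ℓ := by
  have h := aux5 ℓ hℓ s hs p
  refine ⟨h, ?_⟩
  have hlt : ((PhiL ℓ '' (s : Set (ℤ × ℤ))) ∩ ((fun d => p + d) '' DeltaL ℓ)).ncard <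
      ((fun d => p + d) '' DeltaL ℓ).ncard := by
    apply Set.ncard_lt_ncard _ (Set.toFinite _)
    refine ⟨Set.inter_subset_right, fun h' => h fun x hx => (h' hx).1⟩
  have hle : ((fun d => p + d) '' DeltaL ℓ).ncard ≤ ℓ + 1 := by
    refine (Set.ncard_image_le (Set.toFinite _)).trans ?_
    have hD : DeltaL ℓ ⊆ (fun k : ZMod (ℓ + 1) => (k, k)) '' Set.univ := by
      rintro q ⟨k, rfl⟩
      exact ⟨k, trivial, rfl⟩
    refine (Set.ncard_le_ncard hD (Set.toFinite _)).trans ?_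
    refine (Set.ncard_image_le (Set.toFinite _)).trans ?_
    rw [Set.ncard_univ, Nat.card_zmod]
  omega
end

section
/- Let ℓ ≥ 2. Every exceptional set s ⊆ ℤ² with respect to Imm_ℓ has at most ℓ(ℓ+1) elements. -/
open Polynomial TensorProduct

noncomputable section

/-- auxiliary product -/
def qA (m : ℕ) (x : ℚ) : ℚ := ∏ k ∈ Finset.range m, (x + (k + 1))

lemma qA_pred (m : ℕ) (x : ℚ) : qA (m + 1) (x - 1) = x * qA m x := by
  unfold qA
  rw [Finset.prod_range_succ', mul_comm]
  congr 1
  · push_cast; ring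
  · apply Finset.prod_congr rfl
    intro k _
    push_cast; ring

lemma qA_succ (m : ℕ) (x : ℚ) : qA (m + 1) x = qA m x * (x + (m + 1)) := by
  unfold qA
  rw [Finset.prod_range_succ]

/-- Euler characteristic polynomial -/
def qP (m : ℕ) (p : ℤ × ℤ) : ℚ :=
  qA (m + 1) p.1 * qA (m + 1) p.2 - qA (m + 1) (p.1 - 1) * qA (m + 1) (p.2 - 1)

lemma qP_eq (m : ℕ) (p : ℤ × ℤ) :
    qP m p = qA m p.1 * qA m p.2 * ((m + 1) * (p.1 + p.2 + (m + 1))) := by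
  unfold qP
  rw [qA_pred, qA_pred, qA_succ, qA_succ]; ring

lemma qA_zero_of (m : ℕ) (x : ℤ) (h1 : -((m + 1 : ℕ) : ℤ) + 1 ≤ x) (h2 : x ≤ -1) :
    qA m x = 0 := by
  unfold qA
  apply Finset.prod_eq_zero (i := (-x - 1).toNat)
  · rw [Finset.mem_range]; push_cast at h1; omega
  · have : (((-x - 1).toNat : ℤ)) = -x - 1 := Int.toNat_of_nonneg (by omega)
    have h3 : (((-x - 1).toNat : ℚ)) = -x - 1 := by exact_mod_cast this
    rw [h3]; ring

lemma qP_zero_of (m : ℕ) (p : ℤ × ℤ) (h : p ∈ ImmL (m + 1)) : qP m p = 0 := by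
  rw [qP_eq]
  rcases h with (⟨h1, h2⟩ | ⟨h1, h2⟩) | h
  · rw [qA_zero_of m p.2 h1 h2]; ring
  · rw [qA_zero_of m p.1 h1 h2]; ring
  · have h : p.1 + p.2 = -((m + 1 : ℕ) : ℤ) := h
    have h3 : (p.1 : ℚ) + p.2 = -(m + 1) := by exact_mod_cast h
    rw [h3]; ring

lemma qP_zero_ne (m : ℕ) : qP m 0 ≠ 0 := by
  rw [qP_eq]
  have : qA m 0 ≠ 0 := by
    unfold qA
    apply ne_of_gt
    apply Finset.prod_pos
    intro k _
    positivity
  have h2 : (m : ℚ) + 1 ≠ 0 := by positivity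
  simp [this, h2]

/-- bilinear evaluation -/
def bilEv : ℚ[X] →ₗ[ℚ] ℚ[X] →ₗ[ℚ] (ℤ × ℤ → ℚ) :=
  LinearMap.mk₂ ℚ (fun p q u => p.eval (u.1 : ℚ) * q.eval (u.2 : ℚ))
    (by intros; ext; simp; ring) (by intros; ext; simp; ring)
    (by intros; ext; simp; ring) (by intros; ext; simp; ring)

/-- tensor evaluation -/
def tEv (n : ℕ) : (degreeLT ℚ n) ⊗[ℚ] (degreeLT ℚ n) →ₗ[ℚ] (ℤ × ℤ → ℚ) :=
  TensorProduct.lift (bilEv.compl₁₂ (degreeLT ℚ n).subtype (degreeLT ℚ n).subtype)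

/-- space of functions -/
def WW (n : ℕ) : Submodule ℚ (ℤ × ℤ → ℚ) := LinearMap.range (tEv n)

lemma mem_WW (n : ℕ) (p q : ℚ[X]) (hp : p ∈ degreeLT ℚ n) (hq : q ∈ degreeLT ℚ n) :
    (fun u : ℤ × ℤ => p.eval (u.1 : ℚ) * q.eval (u.2 : ℚ)) ∈ WW n :=
  ⟨(⟨p, hp⟩ : degreeLT ℚ n) ⊗ₜ (⟨q, hq⟩ : degreeLT ℚ n), by
    simp [tEv, bilEv]⟩

instance degLT_fin (n : ℕ) : Module.Finite ℚ (degreeLT ℚ n) :=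
  Module.Finite.equiv (degreeLTEquiv ℚ n).symm

lemma degLT_rank (n : ℕ) : Module.finrank ℚ (degreeLT ℚ n) = n := by
  rw [(degreeLTEquiv ℚ n).finrank_eq]; simp

instance WW_fin (n : ℕ) : Module.Finite ℚ (WW n) := by unfold WW; infer_instance

lemma WW_rank (n : ℕ) : Module.finrank ℚ (WW n) ≤ n * n := by
  refine (LinearMap.finrank_range_le (tEv n)).trans ?_
  rw [Module.finrank_tensorProduct, degLT_rank]

/-- difference operator -/
def dOp : (ℤ × ℤ → ℚ) →ₗ[ℚ] (ℤ × ℤ → ℚ) where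
  toFun f u := f u - f (u - 1)
  map_add' f g := by ext; simp; ring
  map_smul' c f := by ext; simp; ring

/-- antidiagonal functions -/
def psi (n : ℕ) : degreeLT ℚ n →ₗ[ℚ] (ℤ × ℤ → ℚ) where
  toFun p u := p.1.eval ((u.1 : ℚ) - u.2)
  map_add' f g := by ext; simp
  map_smul' c f := by ext; simp

lemma psi_inj (n : ℕ) : Function.Injective (psi n) := by
  intro p q h
  apply Subtype.ext
  apply Polynomial.eq_of_infinite_eval_eq
  refine Set.Infinite.mono (s := Set.range (fun k : ℤ => (k : ℚ))) ?_
    (Set.infinite_range_of_injective Int.cast_injective)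
  rintro _ ⟨k, rfl⟩
  have := congrFun h (k, 0)
  simpa [psi] using this

lemma psi_mem (n : ℕ) (p : degreeLT ℚ n) : psi n p ∈ WW n := by
  obtain ⟨p, hp⟩ := p
  have : psi n ⟨p, hp⟩ = ∑ k ∈ p.support, ∑ i ∈ Finset.range (k + 1),
      (p.coeff k * (k.choose i) * (-1) ^ (k - i)) • (fun u : ℤ × ℤ =>
        ((X : ℚ[X]) ^ i).eval (u.1 : ℚ) * ((X : ℚ[X]) ^ (k - i)).eval (u.2 : ℚ)) := by
    ext u
    simp only [psi, LinearMap.coe_mk, AddHom.coe_mk, Finset.sum_apply, Pi.smul_apply, smul_eq_mul,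
      eval_pow, eval_X]
    rw [Polynomial.eval_eq_sum, Polynomial.sum]
    refine Finset.sum_congr rfl fun k _ => ?_
    rw [sub_eq_add_neg, add_pow, Finset.mul_sum]
    refine Finset.sum_congr rfl fun i _ => ?_
    rw [neg_pow]; ring
  rw [this]
  refine Submodule.sum_mem _ fun k hk => Submodule.sum_mem _ fun i hi => Submodule.smul_mem _ _ ?_
  have hkn : k < n := by
    by_contra hcon
    rw [Polynomial.mem_support_iff] at hk
    rw [Polynomial.mem_degreeLT] at hp
    exact hk (Polynomial.coeff_eq_zero_of_degree_lt
      (hp.trans_le (by exact_mod_cast not_lt.mp hcon)))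
  rw [Finset.mem_range] at hi
  apply mem_WW <;> rw [Polynomial.mem_degreeLT, Polynomial.degree_X_pow] <;>
    norm_cast <;> omega

lemma psi_dOp (n : ℕ) (p : degreeLT ℚ n) : dOp (psi n p) = 0 := by
  ext u
  simp [dOp, psi]

lemma map_rank (n : ℕ) : Module.finrank ℚ ((WW n).map dOp) + n ≤ n * n := by
  have h1 := LinearMap.finrank_range_add_finrank_ker (dOp.domRestrict (WW n))
  rw [LinearMap.range_domRestrict] at h1
  have h2 : n ≤ Module.finrank ℚ (LinearMap.ker (dOp.domRestrict (WW n))) := by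
    let g : degreeLT ℚ n →ₗ[ℚ] LinearMap.ker (dOp.domRestrict (WW n)) :=
      ((psi n).codRestrict (WW n) (psi_mem n)).codRestrict _ (by
        intro p
        rw [LinearMap.mem_ker]
        exact psi_dOp n p)
    have hg : Function.Injective g := by
      intro p q h
      apply psi_inj n
      exact congrArg (fun z => z.1.1) h
    have := LinearMap.finrank_le_finrank_of_injective hg
    rwa [degLT_rank] at this
  have := WW_rank n
  omega

/-- polynomial version of the translated product -/
def polA (m : ℕ) (v : ℚ) : ℚ[X] := ∏ k ∈ Finset.range m, (X + C (k + 1 - v))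

lemma polA_eval (m : ℕ) (v x : ℚ) : (polA m v).eval x = qA m (x - v) := by
  unfold polA qA
  rw [Polynomial.eval_prod]
  refine Finset.prod_congr rfl fun k _ => ?_
  simp only [eval_add, eval_X, eval_C]; ring

lemma polA_mem (m : ℕ) (v : ℚ) : polA m v ∈ degreeLT ℚ (m + 1) := by
  rw [Polynomial.mem_degreeLT, polA, Polynomial.degree_prod]
  simp only [Polynomial.degree_X_add_C]
  simp
  norm_cast
  omega

lemma qP_mem (m : ℕ) (v : ℤ × ℤ) : (fun u => qP m (u - v)) ∈ (WW (m + 2)).map dOp := by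
  refine ⟨_, mem_WW _ _ _ (polA_mem (m + 1) v.1) (polA_mem (m + 1) v.2), ?_⟩
  ext u
  simp only [dOp, LinearMap.coe_mk, AddHom.coe_mk, polA_eval, qP, Prod.fst_sub, Prod.snd_sub,
    Prod.fst_one, Prod.snd_one]
  push_cast
  congr 3 <;> ring

lemma main_bound (m n : ℕ) (L : Fin n → ℤ × ℤ) (h : IsExcSeqL (m + 1) n L) :
    n ≤ (m + 1) * (m + 2) := by
  let f : Fin n → (ℤ × ℤ → ℚ) := fun j u => qP m (u - L j)
  have hli : LinearIndependent ℚ f := by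
    let M : Matrix (Fin n) (Fin n) ℚ := fun j i => qP m (L i - L j)
    have hM : M.det ≠ 0 := by
      rw [Matrix.det_of_upperTriangular]
      · refine Finset.prod_ne_zero_iff.mpr fun i _ => ?_
        simp only [M, sub_self]
        exact qP_zero_ne m
      · intro i j hij
        exact qP_zero_of m _ (h j i hij)
    have hr : LinearIndependent ℚ M.row :=
      Matrix.linearIndependent_rows_of_det_ne_zero hM
    exact LinearIndependent.of_comp (LinearMap.funLeft ℚ ℚ L) hr
  have h1 := finrank_span_eq_card hli
  have h2 : Submodule.span ℚ (Set.range f) ≤ (WW (m + 2)).map dOp := by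
    rw [Submodule.span_le]
    rintro _ ⟨j, rfl⟩
    exact qP_mem m (L j)
  have h3 := Submodule.finrank_mono h2
  have h4 := map_rank (m + 2)
  rw [Fintype.card_fin] at h1
  nlinarith

end

/-- every exceptional set on `X_ℓ` has at most `ℓ(ℓ+1)` elements. -/
theorem stmt6 (ℓ : ℕ) (hℓ : 2 ≤ ℓ) (s : Finset (ℤ × ℤ)) (hs : IsExcSetL ℓ s) :
    s.card ≤ ℓ * (ℓ + 1) := by
  obtain ⟨L, _, _, hL⟩ := hs
  obtain ⟨m, rfl⟩ : ∃ m, ℓ = m + 1 := ⟨ℓ - 1, by omega⟩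
  exact main_bound m _ L hL
end

section
/- Let ℓ ≥ 2. The image Φ(Imm_ℓ) of the immaculate locus under coordinatewise reduction modulo ℓ+1 equals the complement of the two-element set {(0̄,0̄), (1̄,1̄)} in (ℤ/(ℓ+1)ℤ)² (these two excluded residues are the classes of the trivial bundle O and of the canonical class K = (−ℓ,−ℓ), respectively). -/
theorem strip_ne (ℓ : ℕ) (n : ℤ) (h1 : -(ℓ : ℤ) + 1 ≤ n) (h2 : n ≤ -1) :
    (n : ZMod (ℓ + 1)) ≠ 0 ∧ (n : ZMod (ℓ + 1)) ≠ 1 := by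
  constructor
  · intro h
    rw [ZMod.intCast_zmod_eq_zero_iff_dvd] at h
    have := Int.le_of_dvd (by omega) ((dvd_neg).2 h)
    push_cast at this
    omega
  · intro h
    have h' : ((n - 1 : ℤ) : ZMod (ℓ + 1)) = 0 := by push_cast; rw [h]; ring
    rw [ZMod.intCast_zmod_eq_zero_iff_dvd] at h'
    have := Int.le_of_dvd (by omega) ((dvd_neg).2 h')
    push_cast at this
    omega

theorem strip_ex (ℓ : ℕ) (z : ZMod (ℓ + 1)) :
    z = 0 ∨ z = 1 ∨ ∃ n : ℤ, -(ℓ : ℤ) + 1 ≤ n ∧ n ≤ -1 ∧ (n : ZMod (ℓ + 1)) = z := by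
  have hz : ((z.val : ℕ) : ZMod (ℓ + 1)) = z := ZMod.natCast_zmod_val z
  have hlt := ZMod.val_lt z
  by_cases h0 : z.val = 0
  · left; rw [← hz, h0]; simp
  by_cases h1 : z.val = 1
  · right; left; rw [← hz, h1]; simp
  right; right
  refine ⟨(z.val : ℤ) - ((ℓ + 1 : ℕ) : ℤ), by push_cast; omega, by push_cast; omega, ?_⟩
  rw [Int.cast_sub, Int.cast_natCast, Int.cast_natCast, hz, ZMod.natCast_self, sub_zero]

/-- `Φ(Imm_ℓ)` is the complement of `{(0,0),(1,1)}` in `(ℤ/(ℓ+1)ℤ)²`,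
the two excluded residues being the classes of `O` and of `K = (−ℓ,−ℓ)`. -/
theorem stmt7 (ℓ : ℕ) (hℓ : 2 ≤ ℓ) :
    PhiL ℓ '' ImmL ℓ =
      ({((0 : ZMod (ℓ + 1)), (0 : ZMod (ℓ + 1))),
        ((1 : ZMod (ℓ + 1)), (1 : ZMod (ℓ + 1)))}ᶜ : Set (ZMod (ℓ + 1) × ZMod (ℓ + 1))) ∧
    PhiL ℓ (0, 0) = ((0 : ZMod (ℓ + 1)), (0 : ZMod (ℓ + 1))) ∧
    PhiL ℓ (-(ℓ : ℤ), -(ℓ : ℤ)) = ((1 : ZMod (ℓ + 1)), (1 : ZMod (ℓ + 1))) := by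
  have hl : ((-(ℓ : ℤ) : ℤ) : ZMod (ℓ + 1)) = 1 := by
    have h := ZMod.natCast_self (ℓ + 1)
    push_cast at h ⊢
    linear_combination -h
  have h01 : (0 : ZMod (ℓ + 1)) ≠ 1 := by
    haveI : Fact (1 < ℓ + 1) := ⟨by omega⟩
    exact zero_ne_one
  refine ⟨?_, by simp [PhiL], by simp only [PhiL, hl]⟩
  ext ⟨a, b⟩
  simp only [Set.mem_image, Set.mem_compl_iff, Set.mem_insert_iff, Set.mem_singleton_iff,
    Prod.mk.injEq, PhiL, ImmL, Set.mem_union, Set.mem_setOf_eq, Prod.exists]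
  constructor
  · rintro ⟨i, j, (⟨h1, h2⟩ | ⟨h1, h2⟩) | h, rfl, rfl⟩
    · have := strip_ne ℓ j h1 h2
      tauto
    · have := strip_ne ℓ i h1 h2
      tauto
    · rw [← h] at hl
      push_cast at hl
      rintro (⟨ha, hb⟩ | ⟨ha, hb⟩)
      · rw [ha, hb, add_zero] at hl
        exact h01 hl
      · rw [ha, hb] at hl
        exact h01 (by linear_combination -hl)
  · intro hn
    obtain ⟨i, hi⟩ := ZMod.intCast_surjective a
    obtain ⟨j, hj⟩ := ZMod.intCast_surjective b
    rcases strip_ex ℓ a with ha | ha | ⟨n, h1, h2, h3⟩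
    · rcases strip_ex ℓ b with hb | hb | ⟨m, k1, k2, k3⟩
      · exact absurd (Or.inl ⟨ha, hb⟩) hn
      · exact ⟨0, -(ℓ : ℤ), Or.inr (by simp), by simp [ha], by rw [hl, hb]⟩
      · exact ⟨i, m, Or.inl (Or.inl ⟨k1, k2⟩), hi, k3⟩
    · rcases strip_ex ℓ b with hb | hb | ⟨m, k1, k2, k3⟩
      · exact ⟨-(ℓ : ℤ), 0, Or.inr (by simp), by rw [hl, ha], by simp [hb]⟩
      · exact absurd (Or.inr ⟨ha, hb⟩) hn
      · exact ⟨i, m, Or.inl (Or.inl ⟨k1, k2⟩), hi, k3⟩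
    · exact ⟨n, j, Or.inl (Or.inr ⟨h1, h2⟩), h3, hj⟩
end

section
/- Let ℓ ≥ 2. The sublattice Λ := {((ℓ+1)a, (ℓ+1)b) : a, b ∈ ℤ} ⊆ ℤ² is admissible for Imm_ℓ, that is, Λ ∩ (Imm_ℓ ∪ (−Imm_ℓ)) = ∅. Consequently, for every exceptional set s ⊆ ℤ² with respect to Imm_ℓ, the coordinatewise reduction map Φ : ℤ² → (ℤ/(ℓ+1)ℤ)² is injective on s. -/
/-- `-Imm_ℓ`. -/
def negImmL (ℓ : ℕ) : Set (ℤ × ℤ) := {p | -p ∈ ImmL ℓ}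

theorem aux_mul (ℓ : ℕ) (c : ℤ) (h1 : -((ℓ : ℤ) + 1) < ((ℓ : ℤ) + 1) * c)
    (h2 : ((ℓ : ℤ) + 1) * c < 0) : False := by
  have hm : (0 : ℤ) < (ℓ : ℤ) + 1 := by positivity
  have a : c < 0 := by
    by_contra h
    push Not at h
    have := mul_nonneg hm.le h
    omega
  have b : -1 < c := by
    by_contra h
    push Not at h
    have := mul_le_mul_of_nonneg_left h hm.le
    omega
  omega

theorem aux_not_mem (ℓ : ℕ) (hℓ : 2 ≤ ℓ) (a b : ℤ) :
    ((((ℓ : ℤ) + 1) * a, ((ℓ : ℤ) + 1) * b) : ℤ × ℤ) ∉ ImmL ℓ := by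
  rintro ((⟨h1, h2⟩ | ⟨h1, h2⟩) | h)
  · exact aux_mul ℓ b (by dsimp only at h1; omega) (by dsimp only at h2; omega)
  · exact aux_mul ℓ a (by dsimp only at h1; omega) (by dsimp only at h2; omega)
  · have h' : ((ℓ : ℤ) + 1) * (a + b) = -(ℓ : ℤ) := by
      rw [mul_add]
      exact h
    exact aux_mul ℓ (a + b) (by omega) (by omega)

theorem aux_phi (ℓ : ℕ) (hℓ : 2 ≤ ℓ) (p q : ℤ × ℤ) (h : PhiL ℓ p = PhiL ℓ q) :
    p - q ∉ ImmL ℓ := by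
  simp only [PhiL, Prod.mk.injEq] at h
  obtain ⟨h1, h2⟩ := h
  rw [eq_comm, ZMod.intCast_eq_intCast_iff_dvd_sub] at h1 h2
  obtain ⟨a, ha⟩ := h1
  obtain ⟨b, hb⟩ := h2
  push_cast at ha hb
  have e : p - q = (((ℓ : ℤ) + 1) * a, ((ℓ : ℤ) + 1) * b) := Prod.ext ha hb
  rw [e]
  exact aux_not_mem ℓ hℓ a b

/-- the sublattice `Λ = (ℓ+1)ℤ × (ℓ+1)ℤ` is admissible for `Imm_ℓ`,
and consequently `Φ` is injective on every exceptional set. -/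
theorem stmt8 (ℓ : ℕ) (hℓ : 2 ≤ ℓ) :
    ({p : ℤ × ℤ | ∃ a b : ℤ, p = (((ℓ : ℤ) + 1) * a, ((ℓ : ℤ) + 1) * b)} ∩
        (ImmL ℓ ∪ negImmL ℓ) = ∅) ∧
    ∀ s : Finset (ℤ × ℤ), IsExcSetL ℓ s → Set.InjOn (PhiL ℓ) ↑s := by
  refine ⟨?_, ?_⟩
  · ext p
    simp only [Set.mem_inter_iff, Set.mem_empty_iff_false, iff_false]
    rintro ⟨⟨a, b, rfl⟩, h | h⟩
    · exact aux_not_mem ℓ hℓ a b h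
    · apply aux_not_mem ℓ hℓ (-a) (-b)
      rw [mul_neg, mul_neg]
      exact h
  · rintro s ⟨L, hinj, hmem, hL⟩ p hp q hq hpq
    have hsurj := Finset.surjOn_of_injOn_of_card_le (s := Finset.univ) (t := s) L
      (fun i _ => hmem i) hinj.injOn (by simp)
    obtain ⟨i, -, rfl⟩ := hsurj hp
    obtain ⟨j, -, rfl⟩ := hsurj hq
    rcases lt_trichotomy i j with h | h | h
    · exact absurd (hL i j h) (aux_phi ℓ hℓ _ _ hpq)
    · rw [h]
    · exact absurd (hL j i h) (aux_phi ℓ hℓ _ _ hpq.symm)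
end

section
/- Let G be an additive abelian group, I ⊆ G a subset, and s ⊆ G an exceptional set with respect to I. Then the reflexive-transitive closure of the relation F(s) on s equals the intersection, over all exceptional linear orders T on s, of the relations {(A,B) ∈ s × s : A ≤_T B}. -/
/-- `-I = {x | -x ∈ I}`. -/
def negSet {G : Type*} [AddCommGroup G] (I : Set G) : Set G := {x | -x ∈ I}

/-- `r` is a linear order on the subset `s`. -/
def IsLinearOrderOn {G : Type*} (s : Set G) (r : G → G → Prop) : Prop :=
  (∀ a ∈ s, r a a) ∧
  (∀ a ∈ s, ∀ b ∈ s, r a b → r b a → a = b) ∧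
  (∀ a ∈ s, ∀ b ∈ s, ∀ c ∈ s, r a b → r b c → r a c) ∧
  (∀ a ∈ s, ∀ b ∈ s, r a b ∨ r b a)

/-- `r` is an exceptional linear order on `s` with respect to `I`. -/
def IsExcOrderOn {G : Type*} [AddCommGroup G] (I : Set G) (s : Set G)
    (r : G → G → Prop) : Prop :=
  IsLinearOrderOn s r ∧ ∀ A ∈ s, ∀ B ∈ s, r A B → A ≠ B → A - B ∈ I

/-- `s` is an exceptional set: it admits an exceptional linear order. -/
def IsExcSet {G : Type*} [AddCommGroup G] (I : Set G) (s : Set G) : Prop :=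
  ∃ r : G → G → Prop, IsExcOrderOn I s r

/-- The generating relation `F(s) = {(A,B) ∈ s × s | A - B ∉ -I}`. -/
def Frel {G : Type*} [AddCommGroup G] (I : Set G) (s : Set G) : Set (G × G) :=
  {q | q.1 ∈ s ∧ q.2 ∈ s ∧ q.1 - q.2 ∉ negSet I}

/-- for an exceptional set `s`, the reflexive-transitive closure of `F(s)`
on `s` equals the intersection over all exceptional linear orders `T` on `s` of the
relations `{(A,B) ∈ s × s | A ≤_T B}`. -/
theorem closure_Frel_eq_inter_excOrders {G : Type*} [AddCommGroup G] (I : Set G)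
    (s : Set G) (hs : IsExcSet I s) :
    {q : G × G | q.1 ∈ s ∧ q.2 ∈ s ∧
        Relation.ReflTransGen (fun x y => (x, y) ∈ Frel I s) q.1 q.2} =
      {q : G × G | q.1 ∈ s ∧ q.2 ∈ s ∧
        ∀ r : G → G → Prop, IsExcOrderOn I s r → r q.1 q.2} := by
  have key : ∀ r : G → G → Prop, IsExcOrderOn I s r → ∀ x y,
      Relation.ReflTransGen (fun x y => (x, y) ∈ Frel I s) x y →
      x = y ∨ (x ∈ s ∧ y ∈ s ∧ r x y) := by
    rintro r ⟨⟨h1, h2, h3, h4⟩, h5⟩ x y h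
    have step : ∀ x y, (x, y) ∈ Frel I s → x ∈ s ∧ y ∈ s ∧ r x y := by
      rintro x y ⟨hx, hy, hn⟩
      refine ⟨hx, hy, ?_⟩
      rcases h4 x hx y hy with h | h
      · exact h
      · by_cases e : y = x
        · subst e; exact h
        · exact absurd (by simpa [negSet] using h5 y hy x hx h e) hn
    induction h with
    | refl => exact Or.inl rfl
    | tail _ hbc ih =>
      obtain ⟨hb, hc, hr⟩ := step _ _ hbc
      rcases ih with rfl | ⟨hx, _, hxr⟩
      · exact Or.inr ⟨hb, hc, hr⟩
      · exact Or.inr ⟨hx, hc, h3 _ hx _ hb _ hc hxr hr⟩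
  ext ⟨a, b⟩
  constructor
  · rintro ⟨ha, hb, h⟩
    refine ⟨ha, hb, fun r hr => ?_⟩
    rcases key r hr _ _ h with e | ⟨_, _, h⟩
    · rw [← e]; exact hr.1.1 _ ha
    · exact h
  · rintro ⟨ha, hb, h⟩
    refine ⟨ha, hb, ?_⟩
    by_contra hn
    simp only at ha hb h hn
    obtain ⟨r₀, hr₀⟩ := hs
    have key0 := key r₀ hr₀
    have hF : ∀ x y, (x, y) ∈ Frel I s →
      Relation.ReflTransGen (fun x y => (x, y) ∈ Frel I s) x y :=
      fun x y h => Relation.ReflTransGen.single h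
    generalize hP : Relation.ReflTransGen (fun x y => (x, y) ∈ Frel I s) = P at *
    have Prefl : ∀ x, P x x := by subst hP; exact fun x => .refl
    have Ptrans : ∀ x y z, P x y → P y z → P x z := by
      subst hP; exact fun x y z h1 h2 => h1.trans h2
    have Panti : ∀ x y, P x y → P y x → x = y := by
      intro x y h1 h2
      rcases key0 _ _ h1 with e | ⟨hx, hy, e1⟩
      · exact e
      rcases key0 _ _ h2 with e | ⟨_, _, e2⟩
      · exact e.symm
      exact hr₀.1.2.1 _ hx _ hy e1 e2
    let Q : G → G → Prop := fun x y => P x y ∨ (P x b ∧ P a y)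
    haveI : IsPartialOrder G Q :=
      { refl := fun x => Or.inl (Prefl x)
        trans := by
          rintro x y z (h1 | ⟨h1, h2⟩) (h3 | ⟨h3, h4⟩)
          · exact Or.inl (Ptrans _ _ _ h1 h3)
          · exact Or.inr ⟨Ptrans _ _ _ h1 h3, h4⟩
          · exact Or.inr ⟨h1, Ptrans _ _ _ h2 h3⟩
          · exact Or.inr ⟨h1, h4⟩
        antisymm := by
          rintro x y (h1 | ⟨h1, h2⟩) (h3 | ⟨h3, h4⟩)
          · exact Panti _ _ h1 h3
          · exact absurd (Ptrans _ _ _ h4 (Ptrans _ _ _ h1 h3)) hn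
          · exact absurd (Ptrans _ _ _ h2 (Ptrans _ _ _ h3 h1)) hn
          · exact absurd (Ptrans _ _ _ h2 h3) hn }
    obtain ⟨L, hL, hQL⟩ := extend_partialOrder Q
    have hLe : IsExcOrderOn I s L := by
      refine ⟨⟨fun x _ => refl_of L x, fun x _ y _ => antisymm_of L,
        fun x _ y _ z _ => trans_of L, fun x _ y _ => total_of L x y⟩, ?_⟩
      intro A hA B hB hAB hne
      by_contra hI
      have : (B, A) ∈ Frel I s := ⟨hB, hA, by simpa [negSet] using hI⟩
      exact hne (antisymm_of L hAB (hQL _ _ (Or.inl (hF _ _ this))))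
    have e : a = b := antisymm_of L (h L hLe) (hQL _ _ (Or.inr ⟨Prefl b, Prefl a⟩))
    exact hn (e ▸ Prefl a)
end

section
/- Let G be an additive abelian group, I, N, E ⊆ G subsets with I ⊆ N, 0 ∈ N, 0 ∈ E and N ⊆ I ∪ E, and let s ⊆ G be an exceptional set with respect to I. Define Eff(s) := {(A,B) ∈ F(s) : B − A ∈ E}. (i) If s is strongly exceptional (B − A ∈ N for all A, B ∈ s), then F(s) = Eff(s), i.e. s is effective. (ii) If in addition E ∩ (−I) ⊆ N, then the converse holds: F(s) = Eff(s) implies that s is strongly exceptional. -/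
/-- `Eff(s) = {(A,B) ∈ F(s) | B - A ∈ E}`. -/
def EffRel {G : Type*} [AddCommGroup G] (I E : Set G) (s : Set G) : Set (G × G) :=
  {q ∈ Frel I s | q.2 - q.1 ∈ E}

/-- (i) a strongly exceptional set is effective (`F(s) = Eff(s)`);
(ii) if moreover `E ∩ (−I) ⊆ N`, the converse holds. -/
theorem stronglyExceptional_and_effective {G : Type*} [AddCommGroup G]
    (I N E : Set G) (hIN : I ⊆ N) (h0N : (0 : G) ∈ N) (h0E : (0 : G) ∈ E)
    (hNIE : N ⊆ I ∪ E) (s : Set G) (hs : IsExcSet I s) :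
    ((∀ A ∈ s, ∀ B ∈ s, B - A ∈ N) → Frel I s = EffRel I E s) ∧
    (E ∩ negSet I ⊆ N → Frel I s = EffRel I E s →
      ∀ A ∈ s, ∀ B ∈ s, B - A ∈ N) := by
  obtain ⟨r, ⟨_, _, _, htot⟩, hr⟩ := hs
  constructor
  · intro h
    ext ⟨A, B⟩
    constructor
    · intro hF
      refine ⟨hF, ?_⟩
      obtain ⟨hA, hB, hn⟩ := hF
      rcases hNIE (h A hA B hB) with h1 | h1
      · exact absurd (show -(A - B) ∈ I by rw [neg_sub]; exact h1) hn
      · exact h1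
    · intro hF
      exact hF.1
  · intro hE hF A hA B hB
    by_cases hAB : A = B
    · subst hAB
      rw [sub_self]
      exact h0N
    by_cases hI : B - A ∈ I
    · exact hIN hI
    have hmem : (A, B) ∈ Frel I s := by
      refine ⟨hA, hB, fun hc => hI ?_⟩
      have hc2 : -(A - B) ∈ I := hc
      rwa [neg_sub] at hc2
    rw [hF] at hmem
    refine hE ⟨hmem.2, ?_⟩
    rcases htot A hA B hB with h1 | h1
    · show -(B - A) ∈ I
      rw [neg_sub]
      exact hr A hA B hB h1 hAB
    · exact absurd (hr B hB A hA h1 (Ne.symm hAB)) hI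
end

section
/- Let G be an additive abelian group, I, E ⊆ G subsets with 0 ∈ E, E + E ⊆ E and E ∩ I = ∅, and let s ⊆ G be an exceptional set with respect to I which is effective, i.e. F(s) = Eff(s) := {(A,B) ∈ F(s) : B − A ∈ E}. Then F(s) is a transitive relation on s; consequently the reflexive-transitive closure of F(s) (which equals the intersection of all exceptional linear orders on s) is F(s) itself. -/
/-- if `E` is an additively closed set containing `0` with `E ∩ I = ∅`
and `s` is an effective exceptional set, then `F(s)` is transitive and its
reflexive-transitive closure on `s` is `F(s)` itself. -/
theorem Frel_transitive_of_effective {G : Type*} [AddCommGroup G] (I E : Set G)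
    (h0E : (0 : G) ∈ E) (hEE : ∀ x ∈ E, ∀ y ∈ E, x + y ∈ E) (hEI : E ∩ I = ∅)
    (s : Set G) (hs : IsExcSet I s) (heff : Frel I s = EffRel I E s) :
    (∀ A B C : G, (A, B) ∈ Frel I s → (B, C) ∈ Frel I s → (A, C) ∈ Frel I s) ∧
    {q : G × G | q.1 ∈ s ∧ q.2 ∈ s ∧
        Relation.ReflTransGen (fun x y => (x, y) ∈ Frel I s) q.1 q.2} = Frel I s := by
  have hE : ∀ x, x ∈ E → x ∉ I := fun x h1 h2 => by
    have h : x ∈ E ∩ I := ⟨h1, h2⟩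
    rw [hEI] at h
    exact h
  have key : ∀ A B : G, (A, B) ∈ Frel I s ↔ A ∈ s ∧ B ∈ s ∧ B - A ∈ E := by
    intro A B
    constructor
    · intro h
      have h' := h
      rw [heff] at h'
      exact ⟨h.1, h.2.1, h'.2⟩
    · rintro ⟨hA, hB, h⟩
      refine ⟨hA, hB, fun hn => hE _ h ?_⟩
      have hn' : -(A - B) ∈ I := hn
      rwa [neg_sub] at hn'
  have tr : ∀ A B C : G, (A, B) ∈ Frel I s → (B, C) ∈ Frel I s → (A, C) ∈ Frel I s := by
    intro A B C h1 h2
    rw [key] at *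
    refine ⟨h1.1, h2.2.1, ?_⟩
    have := hEE _ h2.2.2 _ h1.2.2
    rwa [sub_add_sub_cancel] at this
  refine ⟨tr, ?_⟩
  ext ⟨A, B⟩
  constructor
  · rintro ⟨hA, _, h⟩
    change Relation.ReflTransGen _ A B at h
    induction h with
    | refl => exact (key A A).2 ⟨hA, hA, by rwa [sub_self]⟩
    | tail _ h2 ih => exact tr _ _ _ (ih hA h2.1) h2
  · intro h
    exact ⟨h.1, h.2.1, Relation.ReflTransGen.single h⟩
end

section
/- For every integer a, the length-6 sequence ((0,0),(1,0),(2,0),(a,1),(a+1,1),(a+2,1)) in ℤ² is an exceptional sequence with respect to Imm₂, and it is strongly exceptional if and only if a ≥ 1. -/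
/-- The acyclic locus of `X₂`. -/
def Acyc2 : Set (ℤ × ℤ) := Imm2 ∪ {p | 0 ≤ p.1 ∧ 0 ≤ p.2}

/-- Strongly exceptional: exceptional and `L_b − L_a ∈ Acyc₂` for all `a, b`. -/
def IsStrongExcSeq2 (L : Fin 6 → ℤ × ℤ) : Prop :=
  IsExcSeq2 L ∧ ∀ i j : Fin 6, L j - L i ∈ Acyc2

/-- `((0,0),(1,0),(2,0),(a,1),(a+1,1),(a+2,1))` is always exceptional,
and strongly exceptional iff `a ≥ 1`. -/
theorem stmt16 (a : ℤ) :
    IsExcSeq2 ![(0, 0), (1, 0), (2, 0), (a, 1), (a + 1, 1), (a + 2, 1)] ∧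
    (IsStrongExcSeq2 ![(0, 0), (1, 0), (2, 0), (a, 1), (a + 1, 1), (a + 2, 1)] ↔
      1 ≤ a) := by
  have hE : IsExcSeq2 ![(0, 0), (1, 0), (2, 0), (a, 1), (a + 1, 1), (a + 2, 1)] := by
    intro i j hij
    fin_cases i <;> fin_cases j <;> simp [Imm2] at hij ⊢
  refine ⟨hE, ?_, ?_⟩
  · rintro ⟨-, h⟩
    have h1 := h 2 3
    have h2 := h 1 3
    have h3 := h 0 3
    have h4 := h 0 4
    have h5 := h 0 5
    simp [Acyc2, Imm2] at h1 h2 h3 h4 h5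
    omega
  · intro ha
    refine ⟨hE, ?_⟩
    intro i j
    fin_cases i <;> fin_cases j <;> simp [Acyc2, Imm2] <;> omega
end

section
/- For every integer a, the length-6 sequence ((0,0),(1,0),(a−1,1),(a,1),(a+1,1),(1,2)) in ℤ² is an exceptional sequence with respect to Imm₂, and it is strongly exceptional if and only if a = 1. -/
/-- `((0,0),(1,0),(a−1,1),(a,1),(a+1,1),(1,2))` is always exceptional,
and strongly exceptional iff `a = 1`. -/
theorem stmt17 (a : ℤ) :
    IsExcSeq2 ![(0, 0), (1, 0), (a - 1, 1), (a, 1), (a + 1, 1), (1, 2)] ∧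
    (IsStrongExcSeq2 ![(0, 0), (1, 0), (a - 1, 1), (a, 1), (a + 1, 1), (1, 2)] ↔
      a = 1) := by
  have hE : IsExcSeq2 ![(0, 0), (1, 0), (a - 1, 1), (a, 1), (a + 1, 1), (1, 2)] := by
    intro i j hij
    fin_cases i <;> fin_cases j <;> simp [Imm2] at hij ⊢ <;> omega
  refine ⟨hE, ?_, ?_⟩
  · rintro ⟨-, h⟩
    have h1 := h 1 2
    have h2 := h 1 3
    have h3 := h 4 5
    have h4 := h 3 5
    simp [Acyc2, Imm2] at h1 h2 h3 h4
    omega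
  · rintro rfl
    refine ⟨hE, ?_⟩
    intro i j
    fin_cases i <;> fin_cases j <;> simp [Acyc2, Imm2]
end

section
/- Let C₀ := ((0,0),(0,1),(1,1),(0,2),(1,2),(1,3)) and define inductively C_{n+1} := helixR(C_n), where helixR(L₁,…,L₆) := (L₂,…,L₆, L₁+(2,2)). Then for every n ≥ 0 the sequence C_n is a strongly exceptional sequence with respect to Imm₂ (i.e. this maximal exceptional sequence on X₂ is strongly cyclic). -/
/-- Translate of a sequence. -/
def trans2 (t : ℤ × ℤ) (L : Fin 6 → ℤ × ℤ) : Fin 6 → ℤ × ℤ := fun i => L i + t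

theorem helix_trans2 (t : ℤ × ℤ) (L : Fin 6 → ℤ × ℤ) :
    helixR2 (trans2 t L) = trans2 t (helixR2 L) := by
  funext i
  simp only [helixR2, trans2]
  split_ifs
  · rfl
  · exact add_right_comm _ _ _

theorem helix_iter_trans2 (t : ℤ × ℤ) (L : Fin 6 → ℤ × ℤ) (n : ℕ) :
    helixR2^[n] (trans2 t L) = trans2 t (helixR2^[n] L) := by
  induction n with
  | zero => rfl
  | succ k ih => rw [Function.iterate_succ_apply', ih, helix_trans2, Function.iterate_succ_apply']

theorem helix_six2 (L : Fin 6 → ℤ × ℤ) : helixR2^[6] L = trans2 (2, 2) L := by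
  funext i
  fin_cases i <;> rfl

theorem strong_trans2 (t : ℤ × ℤ) (L : Fin 6 → ℤ × ℤ) (h : IsStrongExcSeq2 L) :
    IsStrongExcSeq2 (trans2 t L) := by
  refine ⟨fun i j hij => ?_, fun i j => ?_⟩
  · simpa [trans2] using h.1 i j hij
  · simpa [trans2] using h.2 i j

theorem base2 (r : Fin 6) :
    IsStrongExcSeq2 (helixR2^[r] ![(0, 0), (0, 1), (1, 1), (0, 2), (1, 2), (1, 3)]) := by
  simp only [IsStrongExcSeq2, IsExcSeq2, Acyc2, Imm2, Set.mem_union, Set.mem_ofPred_eq]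
  revert r
  decide +kernel

/-- every iterated right helix of
`C₀ = ((0,0),(0,1),(1,1),(0,2),(1,2),(1,3))` is strongly exceptional,
i.e. this maximal exceptional sequence is strongly cyclic. -/
theorem stmt18 (n : ℕ) :
    IsStrongExcSeq2 (helixR2^[n] ![(0, 0), (0, 1), (1, 1), (0, 2), (1, 2), (1, 3)]) := by
  induction n using Nat.strong_induction_on with
  | _ n ih =>
    by_cases hn : n < 6
    · exact base2 ⟨n, hn⟩
    · obtain ⟨m, rfl⟩ := Nat.exists_eq_add_of_le (Nat.le_of_not_lt hn)
      rw [Nat.add_comm, Function.iterate_add_apply, helix_six2, helix_iter_trans2]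
      exact strong_trans2 _ _ (ih m (by omega))
end
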